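/- arXiv:1701.05108 — 13 statements merged into one kernel-verified Lean document; each statement's English description precedes it below -/
import Mathlib

section
/- Let V be a finite set of voters, each with favorite candidate in C = {p, g} (p ≠ g), and let κ be a bundling function on V. Let V̄ be a disjoint copy of V via a bijection v ↦ v̄, where the favorite of v̄ is g if v is a p-voter and p if v is a g-voter, and let κ̄ be the induced bundling function on V̄, κ̄(v̄) = {ū : u ∈ κ(v)}. Then for every V' ⊆ V: p is a Plurality winner of the election with candidates {p, g} and voter set V ∖ κ(V') if and only if p is a Plurality winner of the election with candidates {p, g} and voter set V ⊎ κ̄({v̄ : v ∈ V'}) (disjoint union, scores counting voters from both parts). -/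
/-- Filtering commutes with forming the disjoint union of two finsets, at the level of cardinalities. -/
theorem card_filter_image_inl_union_image_inr {α β γ : Type*} [DecidableEq α] [DecidableEq β]
    [DecidableEq γ] (s : Finset α) (t : Finset β) (h : α → γ) (k : β → γ) (c : γ) :
    ((s.image Sum.inl ∪ t.image Sum.inr : Finset (α ⊕ β)).filter
      (fun v => Sum.elim h k v = c)).card =
    (s.filter (fun v => h v = c)).card + (t.filter (fun v => k v = c)).card := by
  rw [Finset.filter_union, Finset.card_union_of_disjoint, Finset.filter_image, Finset.filter_image,
    Finset.card_image_of_injective _ Sum.inl_injective,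
    Finset.card_image_of_injective _ Sum.inr_injective]
  · rfl
  · simp only [Finset.disjoint_left, Finset.mem_filter, Finset.mem_image]
    rintro _ ⟨⟨a, -, rfl⟩, -⟩ ⟨⟨b, -, hb⟩, -⟩
    cases hb

/-- The elements of `univ` satisfying a predicate split into those outside and inside `s`. -/
theorem card_filter_univ_sdiff_add {α : Type*} [Fintype α] [DecidableEq α] (s : Finset α)
    (P : α → Prop) [DecidablePred P] :
    ((Finset.univ \ s).filter P).card + (s.filter P).card = (Finset.univ.filter P).card := by
  rw [← Finset.card_union_of_disjoint, ← Finset.filter_union,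
    Finset.sdiff_union_of_subset (Finset.subset_univ s)]
  exact Finset.disjoint_filter_filter Finset.sdiff_disjoint

/-- Reduction from C-Cons-Del to C-Cons-Add with two candidates:
p wins the election (− κ(V')) on V iff p wins the election V ⊎ κ̄(V̄')
on the complement copy (where every favorite is swapped). -/
theorem stmt_1 {ν C : Type*} [Fintype ν] [DecidableEq ν] [DecidableEq C]
    (p g : C) (hpg : p ≠ g)
    (f : ν → C) (hf : ∀ v, f v = p ∨ f v = g)
    (κ : ν → Finset ν) (hbundle : ∀ v, v ∈ κ v)
    (V' : Finset ν) :
    (∀ c ∈ ({p, g} : Finset C),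
        (((Finset.univ : Finset ν) \ V'.biUnion κ).filter (fun v => f v = c)).card ≤
        (((Finset.univ : Finset ν) \ V'.biUnion κ).filter (fun v => f v = p)).card)
    ↔
    (∀ c ∈ ({p, g} : Finset C),
        ((((Finset.univ : Finset ν).image Sum.inl ∪
            (V'.biUnion κ).image Sum.inr : Finset (ν ⊕ ν))).filter
          (fun v => Sum.elim f (fun u => if f u = p then g else p) v = c)).card ≤
        ((((Finset.univ : Finset ν).image Sum.inl ∪
            (V'.biUnion κ).image Sum.inr : Finset (ν ⊕ ν))).filter
          (fun v => Sum.elim f (fun u => if f u = p then g else p) v = p)).card) := by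
  simp only [Finset.mem_insert, Finset.mem_singleton, forall_eq_or_imp, forall_eq, le_refl,
    true_and, card_filter_image_inl_union_image_inr]
  have hp := card_filter_univ_sdiff_add (V'.biUnion κ) (fun v => f v = p)
  have hg := card_filter_univ_sdiff_add (V'.biUnion κ) (fun v => f v = g)
  have swap_g : ∀ u, (if f u = p then g else p) = g ↔ f u = p := by
    intro u
    split_ifs with h <;> simp [h, hpg]
  have swap_p : ∀ u, (if f u = p then g else p) = p ↔ f u = g := by
    intro u
    rcases hf u with h | h <;> simp [h, hpg, hpg.symm]
  simp only [swap_g, swap_p]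
  omega
end

section
/- Let V be a finite set of voters, each with favorite candidate in C = {p, g} (p ≠ g), and let κ be a bundling function on V. Let V̄ be a disjoint copy of V via a bijection v ↦ v̄, where the favorite of v̄ is g if v is a p-voter and p if v is a g-voter, and let κ̄ be the induced bundling function on V̄, κ̄(v̄) = {ū : u ∈ κ(v)}. Then for every V' ⊆ V: p is NOT a Plurality winner of the election with candidates {p, g} and voter set V ∖ κ(V') if and only if p is NOT a Plurality winner of the election with candidates {p, g} and voter set V ⊎ κ̄({v̄ : v ∈ V'}) (disjoint union, scores counting voters from both parts). -/
open Finset in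
/-- Counting the elements satisfying a predicate in a disjoint union of two finsets. -/
theorem card_filter_image_inl_union_image_inr_s2 {α β : Type*} [DecidableEq α] [DecidableEq β]
    (A : Finset α) (B : Finset β) (P : α ⊕ β → Prop) [DecidablePred P] :
    ((A.image Sum.inl ∪ B.image Sum.inr : Finset (α ⊕ β)).filter P).card =
      (A.filter (fun a => P (Sum.inl a))).card + (B.filter (fun b => P (Sum.inr b))).card := by
  rw [filter_union, filter_image, filter_image, card_union_of_disjoint,
    card_image_of_injective _ Sum.inl_injective, card_image_of_injective _ Sum.inr_injective]
  rw [disjoint_left]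
  simp

/-- The elements of a finite type satisfying a predicate split along any finset. -/
theorem card_filter_univ_sdiff_add_card_filter {α : Type*} [Fintype α] [DecidableEq α]
    (A : Finset α) (P : α → Prop) [DecidablePred P] :
    ((Finset.univ \ A).filter P).card + (A.filter P).card =
      ((Finset.univ : Finset α).filter P).card := by
  rw [← Finset.card_union_of_disjoint
    (Finset.disjoint_filter_filter Finset.sdiff_disjoint), ← Finset.filter_union,
    Finset.sdiff_union_of_subset (Finset.subset_univ A)]

/-- Reduction from C-Cons-Del to C-Cons-Add with two candidates:
p loses the election (− κ(V')) on V iff p loses the election V ⊎ κ̄(V̄')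
on the complement copy (where every favorite is swapped). -/
theorem stmt_2 {ν C : Type*} [Fintype ν] [DecidableEq ν] [DecidableEq C]
    (p g : C) (hpg : p ≠ g)
    (f : ν → C) (hf : ∀ v, f v = p ∨ f v = g)
    (κ : ν → Finset ν) (hbundle : ∀ v, v ∈ κ v)
    (V' : Finset ν) :
    (¬ ∀ c ∈ ({p, g} : Finset C),
        (((Finset.univ : Finset ν) \ V'.biUnion κ).filter (fun v => f v = c)).card ≤
        (((Finset.univ : Finset ν) \ V'.biUnion κ).filter (fun v => f v = p)).card)
    ↔
    (¬ ∀ c ∈ ({p, g} : Finset C),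
        ((((Finset.univ : Finset ν).image Sum.inl ∪
            (V'.biUnion κ).image Sum.inr : Finset (ν ⊕ ν))).filter
          (fun v => Sum.elim f (fun u => if f u = p then g else p) v = c)).card ≤
        ((((Finset.univ : Finset ν).image Sum.inl ∪
            (V'.biUnion κ).image Sum.inr : Finset (ν ⊕ ν))).filter
          (fun v => Sum.elim f (fun u => if f u = p then g else p) v = p)).card) := by
  have swap_g : ∀ u, ((if f u = p then g else p) = g) ↔ f u = p := by
    intro u
    split_ifs with h <;> simp [h, hpg]
  have swap_p : ∀ u, ((if f u = p then g else p) = p) ↔ f u = g := by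
    intro u
    rcases hf u with h | h <;> simp [h, hpg, hpg.symm]
  have split_p := card_filter_univ_sdiff_add_card_filter (V'.biUnion κ) (fun v => f v = p)
  have split_g := card_filter_univ_sdiff_add_card_filter (V'.biUnion κ) (fun v => f v = g)
  have score : ∀ c, ((((Finset.univ : Finset ν).image Sum.inl ∪
      (V'.biUnion κ).image Sum.inr : Finset (ν ⊕ ν))).filter
        (fun v => Sum.elim f (fun u => if f u = p then g else p) v = c)).card =
      (Finset.univ.filter (fun v => f v = c)).card +
        ((V'.biUnion κ).filter (fun u => (if f u = p then g else p) = c)).card :=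
    fun _ => card_filter_image_inl_union_image_inr_s2 _ _ _
  have score_p := score p
  have score_g := score g
  rw [Finset.filter_congr (fun u _ => swap_p u)] at score_p
  rw [Finset.filter_congr (fun u _ => swap_g u)] at score_g
  simp only [Finset.mem_insert, Finset.mem_singleton, forall_eq_or_imp, forall_eq, le_refl,
    true_and]
  omega
end

section
/- Let G be a finite simple undirected graph with vertex set {u_1, …, u_n} and let h ∈ ℕ. Consider the election with candidates C = {p, g} and voter set V = {w_1, …, w_n}, where each w_i is a g-voter, with the bundling function κ(w_i) = {w_j : u_j ∈ N[u_i]}. Then κ is symmetric, and G has a dominating set of size at most h if and only if there exists V' ⊆ V with |V'| ≤ h such that p is a Plurality winner of (C, V ∖ κ(V')). -/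
/-- Dominating-set reduction for C-Cons-Del with two candidates p, g:
all voters are g-voters w_u (one per vertex), κ(w_u) = N[u]; κ is symmetric and
G has a dominating set of size ≤ h iff some V' of size ≤ h makes p a Plurality
winner of (C, V ∖ κ(V')). -/
theorem stmt_3 {V C : Type*} [Fintype V] [DecidableEq V] [DecidableEq C]
    (G : SimpleGraph V) [DecidableRel G.Adj]
    (p g : C) (hpg : p ≠ g) (h : ℕ)
    (f : V → C) (hf : ∀ v, f v = g)
    (κ : V → Finset V) (hκ : ∀ u, κ u = insert u (G.neighborFinset u)) :
    (∀ x y : V, y ∈ κ x ↔ x ∈ κ y) ∧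
    ((∃ U : Finset V, U.card ≤ h ∧ ∀ v : V, ∃ u ∈ U, v ∈ insert u (G.neighborFinset u)) ↔
     (∃ V' : Finset V, V'.card ≤ h ∧
        ∀ c ∈ ({p, g} : Finset C),
          (((Finset.univ : Finset V) \ V'.biUnion κ).filter (fun v => f v = c)).card ≤
          (((Finset.univ : Finset V) \ V'.biUnion κ).filter (fun v => f v = p)).card)) := by
  refine ⟨fun x y => by simp [hκ, G.adj_comm, eq_comm], 
    exists_congr fun U => and_congr_right fun _ => ?_⟩
  have dominates_iff : (∀ v : V, ∃ u ∈ U, v ∈ insert u (G.neighborFinset u)) ↔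
      (Finset.univ : Finset V) \ U.biUnion κ = ∅ := by
    simp only [← hκ, Finset.sdiff_eq_empty_iff_subset, Finset.subset_iff, Finset.mem_univ,
      true_imp_iff, Finset.mem_biUnion]
  rw [dominates_iff]
  simp [hf, hpg.symm]
end

section
/- Let G be a finite simple undirected graph with vertex set {u_1, …, u_n}, n ≥ 1, and let h ∈ ℕ. Consider the election with candidates C = {p, g}, registered voters V consisting of n − 1 p-voters, and unregistered voters W = {w_1, …, w_n} (disjoint from V), where each w_i is a g-voter, with bundling function κ(w_i) = {w_j : u_j ∈ N[u_i]} on W. Then G has a dominating set of size at most h if and only if there exists W' ⊆ W with |W'| ≤ h such that p is NOT a Plurality winner of (C, V ∪ κ(W')). -/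
/-- The candidate favoured exactly by the left voters scores the number of left voters. -/
lemma card_filter_elim_eq_left {A B C : Type*} [DecidableEq A] [DecidableEq B] [DecidableEq C]
    {p g : C} (hpg : p ≠ g) (S : Finset A) (T : Finset B) :
    ((S.image Sum.inl ∪ T.image Sum.inr : Finset (A ⊕ B)).filter
      (fun v => Sum.elim (fun _ => p) (fun _ => g) v = p)).card = S.card := by
  rw [← Finset.card_image_of_injective S (Sum.inl_injective (β := B))]
  congr 1
  ext (a | b) <;> simp [hpg.symm]

/-- The candidate favoured exactly by the right voters scores the number of right voters. -/
lemma card_filter_elim_eq_right {A B C : Type*} [DecidableEq A] [DecidableEq B] [DecidableEq C]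
    {p g : C} (hpg : p ≠ g) (S : Finset A) (T : Finset B) :
    ((S.image Sum.inl ∪ T.image Sum.inr : Finset (A ⊕ B)).filter
      (fun v => Sum.elim (fun _ => p) (fun _ => g) v = g)).card = T.card := by
  rw [← Finset.card_image_of_injective T (Sum.inr_injective (α := A))]
  congr 1
  ext (a | b) <;> simp [hpg]

/-- Dominating-set reduction for C-Des-Add with two candidates p, g:
registered voters are n−1 p-voters, unregistered voters are g-voters w_u (one
per vertex) with κ(w_u) = N[u]; G has a dominating set of size ≤ h iff some
W' of size ≤ h makes p not a Plurality winner of (C, V ∪ κ(W')). -/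
theorem stmt_4 {V C : Type*} [Fintype V] [DecidableEq V] [DecidableEq C]
    (G : SimpleGraph V) [DecidableRel G.Adj]
    (hn : 1 ≤ Fintype.card V)
    (p g : C) (hpg : p ≠ g) (h : ℕ)
    (κ : V → Finset V) (hκ : ∀ u, κ u = insert u (G.neighborFinset u)) :
    (∃ U : Finset V, U.card ≤ h ∧ ∀ v : V, ∃ u ∈ U, v ∈ insert u (G.neighborFinset u)) ↔
    (∃ W' : Finset V, W'.card ≤ h ∧
      ¬ ∀ c ∈ ({p, g} : Finset C),
        ((((Finset.univ : Finset (Fin (Fintype.card V - 1))).image Sum.inl ∪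
            (W'.biUnion κ).image Sum.inr : Finset (Fin (Fintype.card V - 1) ⊕ V))).filter
          (fun v => Sum.elim (fun _ => p) (fun _ => g) v = c)).card ≤
        ((((Finset.univ : Finset (Fin (Fintype.card V - 1))).image Sum.inl ∪
            (W'.biUnion κ).image Sum.inr : Finset (Fin (Fintype.card V - 1) ⊕ V))).filter
          (fun v => Sum.elim (fun _ => p) (fun _ => g) v = p)).card) := by
  have covers_iff (U : Finset V) :
      (∀ v : V, ∃ u ∈ U, v ∈ insert u (G.neighborFinset u)) ↔
        Fintype.card V - 1 < (U.biUnion κ).card := by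
    have hle := Finset.card_le_univ (U.biUnion κ)
    calc (∀ v : V, ∃ u ∈ U, v ∈ insert u (G.neighborFinset u))
        ↔ U.biUnion κ = Finset.univ := by
          simp only [Finset.eq_univ_iff_forall, Finset.mem_biUnion, hκ]
      _ ↔ (U.biUnion κ).card = Fintype.card V := (Finset.card_eq_iff_eq_univ _).symm
      _ ↔ Fintype.card V - 1 < (U.biUnion κ).card := by omega
  refine exists_congr fun U => and_congr_right fun _ => ?_
  rw [covers_iff]
  simp only [Finset.mem_insert, Finset.mem_singleton, forall_eq_or_imp, forall_eq, le_refl,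
    true_and, card_filter_elim_eq_left hpg, card_filter_elim_eq_right hpg, Finset.card_univ,
    Fintype.card_fin, not_le]
end

section
/- Let G be a finite simple undirected graph with vertex set {u_1, …, u_n} and let h ∈ ℕ. Consider the election with candidates C = {p, g} and voter set V = {w_1, …, w_n} ∪ {w'}, where each w_i is a p-voter and w' is a g-voter, with bundling function κ(w_i) = {w_j : u_j ∈ N[u_i]} and κ(w') = {w'}. Then G has a dominating set of size at most h if and only if there exists V' ⊆ V with |V'| ≤ h such that p is NOT a Plurality winner of (C, V ∖ κ(V')). -/
/-- Dominating-set reduction for C-Des-Del with two candidates p, g: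
voters are p-voters w_u (one per vertex, κ(w_u) = N[u]) and one g-voter w'
with singleton bundle; G has a dominating set of size ≤ h iff some V' of
size ≤ h makes p not a Plurality winner of (C, V ∖ κ(V')). -/
theorem stmt_5 {V C : Type*} [Fintype V] [DecidableEq V] [DecidableEq C]
    (G : SimpleGraph V) [DecidableRel G.Adj]
    (p g : C) (hpg : p ≠ g) (h : ℕ)
    (κ : V ⊕ Unit → Finset (V ⊕ Unit))
    (hκ1 : ∀ u : V, κ (Sum.inl u) = (insert u (G.neighborFinset u)).image Sum.inl)
    (hκ2 : κ (Sum.inr ()) = {Sum.inr ()}) :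
    (∃ U : Finset V, U.card ≤ h ∧ ∀ v : V, ∃ u ∈ U, v ∈ insert u (G.neighborFinset u)) ↔
    (∃ V' : Finset (V ⊕ Unit), V'.card ≤ h ∧
      ¬ ∀ c ∈ ({p, g} : Finset C),
        (((Finset.univ : Finset (V ⊕ Unit)) \ V'.biUnion κ).filter
          (fun v => Sum.elim (fun _ => p) (fun _ => g) v = c)).card ≤
        (((Finset.univ : Finset (V ⊕ Unit)) \ V'.biUnion κ).filter
          (fun v => Sum.elim (fun _ => p) (fun _ => g) v = p)).card) := by
  classical
  constructor
  · rintro ⟨U, hU, hdom⟩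
    refine ⟨U.map Function.Embedding.inl, by simpa using hU, fun hwin => ?_⟩
    have hg := hwin g (by simp)
    rw [Finset.card_eq_zero.2 (Finset.filter_eq_empty_iff (p := fun v => _ = p).2 ?_)] at hg
    · have hempty := Finset.card_eq_zero.1 (Nat.le_zero.1 hg)
      refine Finset.filter_eq_empty_iff.1 hempty (x := Sum.inr ()) ?_ rfl
      simp [hκ1]
    · rintro (v | w) hv
      · obtain ⟨u, hu, huv⟩ := hdom v
        refine absurd ?_ (Finset.mem_sdiff.1 hv).2
        refine Finset.mem_biUnion.2 ⟨Sum.inl u, by simpa using hu, ?_⟩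
        rw [hκ1]
        exact Finset.mem_image_of_mem _ huv
      · exact hpg.symm
  · rintro ⟨V', hV', hlose⟩
    refine ⟨V'.toLeft, Finset.card_toLeft_le.trans hV', fun v => ?_⟩
    by_contra! hv
    refine hlose fun c hc => ?_
    rcases Finset.mem_insert.1 hc with rfl | hc
    · exact le_rfl
    obtain rfl := Finset.mem_singleton.1 hc
    refine le_trans (b := 1) (Finset.card_le_one.2 ?_) (Finset.card_pos.2 ⟨Sum.inl v, ?_⟩)
    · rintro (a | a) ha (b | b) hb
      · exact absurd (Finset.mem_filter.1 ha).2 hpg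
      · exact absurd (Finset.mem_filter.1 ha).2 hpg
      · exact absurd (Finset.mem_filter.1 hb).2 hpg
      · rfl
    · refine Finset.mem_filter.2 ⟨Finset.mem_sdiff.2 ⟨Finset.mem_univ _, fun hmem => ?_⟩, rfl⟩
      obtain ⟨u | w, hu, huv⟩ := Finset.mem_biUnion.1 hmem
      · rw [hκ1] at huv
        exact hv u (Finset.mem_toLeft.2 hu)
          ((Finset.mem_image.1 huv).elim fun x hx => Sum.inl_injective hx.2 ▸ hx.1)
      · simp [hκ2] at huv
end

section
/- Let G = (V(G), E(G)) be a finite simple undirected graph with n vertices and m edges, and let h ∈ ℕ with h > 3 and m ≥ n + h(h−1)/2 − h. Consider the election with candidates C = {p, g} and voter set V consisting of: one p-voter w_u for each vertex u ∈ V(G) with κ(w_u) = {w_u}; one g-voter w_e for each edge e = {u, u'} ∈ E(G) with κ(w_e) = {w_e, w_u, w_{u'}}; and m − n − (h(h−1)/2 − h) additional dummy p-voters, each with singleton bundle (so that s_g(V) − s_p(V) = h(h−1)/2 − h). Then G has a clique of size h if and only if there exists V' ⊆ V with |V'| ≤ h(h−1)/2 such that p is a Plurality winner of (C, V ∖ κ(V')).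 -/
/-- Voters of the Clique reduction for C-Cons-Del: one p-voter per vertex
(singleton bundle), one g-voter per edge (bundled with its endpoints' voters),
and m − n − (h(h−1)/2 − h) dummy p-voters with singleton bundles. -/
abbrev Voter6 {V : Type*} [Fintype V] [DecidableEq V]
    (G : SimpleGraph V) [DecidableRel G.Adj] (h : ℕ) :=
  V ⊕ ({e : Sym2 V // e ∈ G.edgeFinset} ⊕
    Fin (G.edgeFinset.card - Fintype.card V - (h * (h - 1) / 2 - h)))

open Finset

section Voters

variable {α β γ C : Type*} [DecidableEq C]

lemma card_filter_sumElim_eq_left (S : Finset (α ⊕ (β ⊕ γ))) {p g : C} (hpg : p ≠ g) :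
    (S.filter (fun v => Sum.elim (fun _ => p) (Sum.elim (fun _ => g) (fun _ => p)) v = p)).card
      = S.toLeft.card + S.toRight.toRight.card := by
  classical
  rw [← card_toLeft_add_card_toRight, ← card_toLeft_add_card_toRight (u := toRight _)]
  have h₁ : (S.filter (fun v => Sum.elim (fun _ => p)
      (Sum.elim (fun _ => g) (fun _ => p)) v = p)).toLeft = S.toLeft := by
    ext; simp
  have h₂ : (S.filter (fun v => Sum.elim (fun _ => p)
      (Sum.elim (fun _ => g) (fun _ => p)) v = p)).toRight.toLeft = ∅ := by
    ext; simp [hpg.symm]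
  have h₃ : (S.filter (fun v => Sum.elim (fun _ => p)
      (Sum.elim (fun _ => g) (fun _ => p)) v = p)).toRight.toRight = S.toRight.toRight := by
    ext; simp
  rw [h₁, h₂, h₃]
  simp

lemma card_filter_sumElim_eq_middle (S : Finset (α ⊕ (β ⊕ γ))) {p g : C} (hpg : p ≠ g) :
    (S.filter (fun v => Sum.elim (fun _ => p) (Sum.elim (fun _ => g) (fun _ => p)) v = g)).card
      = S.toRight.toLeft.card := by
  classical
  rw [← card_toLeft_add_card_toRight, ← card_toLeft_add_card_toRight (u := toRight _)]
  have h₁ : (S.filter (fun v => Sum.elim (fun _ => p)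
      (Sum.elim (fun _ => g) (fun _ => p)) v = g)).toLeft = ∅ := by
    ext; simp [hpg]
  have h₂ : (S.filter (fun v => Sum.elim (fun _ => p)
      (Sum.elim (fun _ => g) (fun _ => p)) v = g)).toRight.toLeft = S.toRight.toLeft := by
    ext; simp
  have h₃ : (S.filter (fun v => Sum.elim (fun _ => p)
      (Sum.elim (fun _ => g) (fun _ => p)) v = g)).toRight.toRight = ∅ := by
    ext; simp [hpg]
  rw [h₁, h₂, h₃]
  simp

variable [Fintype α] [Fintype β] [Fintype γ] [DecidableEq α] [DecidableEq β] [DecidableEq γ]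

/-- After deleting the voters in `W`, `p` wins iff the deleted `g`-voters outnumber the deleted
`p`-voters by at least the original deficit of `p`. -/
lemma plurality_winner_sdiff_iff (W : Finset (α ⊕ (β ⊕ γ))) {p g : C} (hpg : p ≠ g) :
    (∀ c ∈ ({p, g} : Finset C),
      ((univ \ W).filter
        (fun v => Sum.elim (fun _ => p) (Sum.elim (fun _ => g) (fun _ => p)) v = c)).card ≤
      ((univ \ W).filter
        (fun v => Sum.elim (fun _ => p) (Sum.elim (fun _ => g) (fun _ => p)) v = p)).card) ↔
    Fintype.card β + W.toLeft.card + W.toRight.toRight.card ≤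
      Fintype.card α + Fintype.card γ + W.toRight.toLeft.card := by
  have h₁ : (univ \ W).toLeft = W.toLeftᶜ := by ext; simp
  have h₂ : (univ \ W).toRight.toLeft = W.toRight.toLeftᶜ := by ext; simp
  have h₃ : (univ \ W).toRight.toRight = W.toRight.toRightᶜ := by ext; simp
  simp only [mem_insert, mem_singleton, forall_eq_or_imp, forall_eq, le_refl, true_and]
  rw [card_filter_sumElim_eq_left _ hpg, card_filter_sumElim_eq_middle _ hpg, h₁, h₂, h₃,
    card_compl, card_compl, card_compl]
  have := card_le_univ W.toLeft
  have := card_le_univ W.toRight.toLeft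
  have := card_le_univ W.toRight.toRight
  omega

end Voters

section Graph

variable {V : Type*} [DecidableEq V]

lemma mem_image_offDiag_sym2Mk {T : Finset V} {e : Sym2 V} :
    e ∈ T.offDiag.image Sym2.mk.uncurry ↔ ¬ e.IsDiag ∧ ∀ u ∈ e, u ∈ T := by
  induction e with | _ x y =>
  simp only [mem_image, mem_offDiag, Prod.exists, Function.uncurry, Sym2.eq_iff,
    Sym2.mk_isDiag_iff, Sym2.mem_iff, forall_eq_or_imp, forall_eq]
  grind

variable [Fintype V] (G : SimpleGraph V) [DecidableRel G.Adj]

lemma subset_image_offDiag_of_subset_edgeFinset {F : Finset (Sym2 V)} {T : Finset V}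
    (hF : F ⊆ G.edgeFinset) (hT : ∀ e ∈ F, ∀ u ∈ e, u ∈ T) :
    F ⊆ T.offDiag.image Sym2.mk.uncurry := fun e he =>
  mem_image_offDiag_sym2Mk.2
    ⟨G.not_isDiag_of_mem_edgeSet (SimpleGraph.mem_edgeFinset.1 (hF he)), hT e he⟩

lemma adj_of_choose_two_le_card {F : Finset (Sym2 V)} {T : Finset V}
    (hF : F ⊆ G.edgeFinset) (hT : ∀ e ∈ F, ∀ u ∈ e, u ∈ T) (hc : T.card.choose 2 ≤ F.card) :
    ∀ x ∈ T, ∀ y ∈ T, x ≠ y → G.Adj x y := by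
  intro x hx y hy hxy
  have h := eq_of_subset_of_card_le (subset_image_offDiag_of_subset_edgeFinset G hF hT)
    (by rwa [Sym2.card_image_offDiag])
  have : s(x, y) ∈ F := by
    rw [h, mem_image_offDiag_sym2Mk]
    simp [hxy, hx, hy]
  simpa using hF this

lemma image_offDiag_subset_edgeFinset {U : Finset V}
    (hU : ∀ x ∈ U, ∀ y ∈ U, x ≠ y → G.Adj x y) :
    U.offDiag.image Sym2.mk.uncurry ⊆ G.edgeFinset := by
  intro e he
  rw [mem_image_offDiag_sym2Mk] at he
  induction e with | _ x y =>
  simp only [Sym2.mk_isDiag_iff, Sym2.mem_iff, forall_eq_or_imp, forall_eq] at he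
  simpa using hU x he.2.1 y he.2.2 he.1

end Graph

lemma eq_of_choose_two_deficit {h s a : ℕ} (hh : 3 < h) (ha : a ≤ h.choose 2)
    (hs : s + h.choose 2 ≤ a + h) (has : a ≤ s.choose 2) : s = h := by
  obtain ⟨j, rfl⟩ : ∃ j, h = s + j := ⟨h - s, by omega⟩
  have e₁ := Nat.choose_two_right (s + j)
  have e₂ := Nat.choose_two_right s
  have d₁ := Nat.div_two_mul_two_of_even (Nat.even_mul_pred_self (s + j))
  have d₂ := Nat.div_two_mul_two_of_even (Nat.even_mul_pred_self s)
  rw [← e₁] at d₁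
  rw [← e₂] at d₂
  rcases Nat.eq_zero_or_pos j with rfl | hj
  · rfl
  exfalso
  rcases s with _ | s
  · simp at has d₁ hs
    obtain ⟨k, rfl⟩ : ∃ k, j = k + 4 := ⟨j - 4, by omega⟩
    simp at d₁
    nlinarith
  · have : s + 1 + j - 1 = s + j := by omega
    rw [this] at d₁
    simp only [Nat.add_sub_cancel] at d₂
    nlinarith

/-- Clique reduction for C-Cons-Del with two candidates p, g:
G has a clique of size h iff some V' of size ≤ h(h−1)/2 makes p a Plurality
winner of (C, V ∖ κ(V')). -/
theorem stmt_6 {V C : Type*} [Fintype V] [DecidableEq V] [DecidableEq C]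
    (G : SimpleGraph V) [DecidableRel G.Adj]
    (p g : C) (hpg : p ≠ g) (h : ℕ) (hh : 3 < h)
    (hm : Fintype.card V + (h * (h - 1) / 2 - h) ≤ G.edgeFinset.card)
    (κ : Voter6 G h → Finset (Voter6 G h))
    (hκ1 : ∀ u : V, κ (Sum.inl u) = {Sum.inl u})
    (hκ2 : ∀ e : {e : Sym2 V // e ∈ G.edgeFinset},
      κ (Sum.inr (Sum.inl e)) =
        insert (Sum.inr (Sum.inl e))
          ((Finset.univ.filter (fun u : V => u ∈ (e : Sym2 V))).image Sum.inl))
    (hκ3 : ∀ d, κ (Sum.inr (Sum.inr d)) = {Sum.inr (Sum.inr d)}) :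
    (∃ U : Finset V, U.card = h ∧ ∀ x ∈ U, ∀ y ∈ U, x ≠ y → G.Adj x y) ↔
    (∃ V' : Finset (Voter6 G h), V'.card ≤ h * (h - 1) / 2 ∧
      ∀ c ∈ ({p, g} : Finset C),
        ((Finset.univ \ V'.biUnion κ).filter
          (fun v => Sum.elim (fun _ => p) (Sum.elim (fun _ => g) (fun _ => p)) v = c)).card ≤
        ((Finset.univ \ V'.biUnion κ).filter
          (fun v => Sum.elim (fun _ => p) (Sum.elim (fun _ => g) (fun _ => p)) v = p)).card) := by
  have hK : h ≤ h * (h - 1) / 2 := by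
    rw [Nat.le_div_iff_mul_le two_pos]
    exact Nat.mul_le_mul_left h (by omega)
  have mem_left : ∀ (V' : Finset (Voter6 G h)) (u : V), Sum.inl u ∈ V'.biUnion κ ↔
      Sum.inl u ∈ V' ∨ ∃ e, Sum.inr (Sum.inl e) ∈ V' ∧ u ∈ (e : Sym2 V) := by
    intro V' u
    simp [Sum.exists, hκ1, hκ2, hκ3]
  have mem_right : ∀ (V' : Finset (Voter6 G h)) x, Sum.inr x ∈ V'.biUnion κ ↔
      Sum.inr x ∈ V' := by
    rintro V' (x | x) <;> simp [Sum.exists, hκ1, hκ2, hκ3]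
  have toRight_eq : ∀ V' : Finset (Voter6 G h), (V'.biUnion κ).toRight = V'.toRight := by
    intro V'
    ext x
    rw [mem_toRight, mem_toRight, mem_right]
  have winner_iff : ∀ V' : Finset (Voter6 G h),
      (V'.biUnion κ).toLeft.card + V'.toRight.toRight.card + h * (h - 1) / 2 ≤
        V'.toRight.toLeft.card + h ↔ _ := fun V' =>
    Iff.trans (by
      rw [toRight_eq, Fintype.card_coe, Fintype.card_fin]
      omega) (plurality_winner_sdiff_iff (V'.biUnion κ) hpg).symm
  simp only [← winner_iff]
  constructor
  · rintro ⟨U, rfl, hU⟩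
    set E : Finset {e : Sym2 V // e ∈ G.edgeFinset} :=
      (U.offDiag.image Sym2.mk.uncurry).subtype (· ∈ G.edgeFinset) with hE
    have hEcard : E.card = U.card * (U.card - 1) / 2 := by
      rw [hE, card_subtype, filter_true_of_mem (image_offDiag_subset_edgeFinset G hU),
        Sym2.card_image_offDiag, Nat.choose_two_right]
    refine ⟨E.map (Function.Embedding.inl.trans Function.Embedding.inr), by simp [hEcard], ?_⟩
    set V' : Finset (Voter6 G U.card) :=
      E.map (Function.Embedding.inl.trans Function.Embedding.inr) with hV'
    have h₁ : (V'.biUnion κ).toLeft ⊆ U := by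
      intro u hu
      rw [mem_toLeft, mem_left] at hu
      obtain hu | ⟨e, he, hue⟩ := hu
      · simp [hV'] at hu
      · have he' : e ∈ E := by simpa [hV'] using he
        rw [hE, mem_subtype, mem_image_offDiag_sym2Mk] at he'
        exact he'.2 u hue
    have h₂ : V'.toRight.toRight = ∅ := by ext; simp [hV']
    have h₃ : V'.toRight.toLeft = E := by ext; simp [hV']
    have := card_le_card h₁
    rw [h₂, h₃, hEcard, card_empty]
    omega
  · rintro ⟨V', hcard, hwin⟩
    set T := (V'.biUnion κ).toLeft
    set F : Finset (Sym2 V) := V'.toRight.toLeft.map (Function.Embedding.subtype _)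
    have hFcard : F.card = V'.toRight.toLeft.card := card_map _
    have hFE : F ⊆ G.edgeFinset := by
      intro e he
      obtain ⟨e, -, rfl⟩ := mem_map.1 he
      exact e.2
    have hFT : ∀ e ∈ F, ∀ u ∈ e, u ∈ T := by
      intro e he u hu
      obtain ⟨e, heV, rfl⟩ := mem_map.1 he
      exact mem_toLeft.2 ((mem_left V' u).2 (Or.inr ⟨e, mem_toRight.1 (mem_toLeft.1 heV), hu⟩))
    have hle : F.card ≤ T.card.choose 2 := by
      rw [← Sym2.card_image_offDiag]
      exact card_le_card (subset_image_offDiag_of_subset_edgeFinset G hFE hFT)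
    have hFle : F.card ≤ h.choose 2 := by
      have h₁ := card_toLeft_add_card_toRight (u := V')
      have h₂ := card_toLeft_add_card_toRight (u := V'.toRight)
      rw [Nat.choose_two_right]
      omega
    have hchoose := Nat.choose_two_right h
    have hT : T.card = h := eq_of_choose_two_deficit hh hFle (by omega) hle
    refine ⟨T, hT, adj_of_choose_two_le_card G hFE hFT ?_⟩
    rw [hT]
    omega
end

section
/- Let F = {f_1, …, f_m} be a (2-2)-3SAT formula over variables x_1, …, x_n (n ≥ 1): each clause has two or three literals and each variable occurs exactly twice as a positive and exactly twice as a negative literal. Construct the election with candidates C = {p, d} ∪ {c_j : f_j ∈ F} and the following voters and bundles: (1) for each variable x_i, letting f_j, f_r (j < r) be the clauses containing literal x_i and f_s, f_t (s < t) the clauses containing ¬x_i, introduce d-voters v_i^j, v_i^s, v_i^r, v_i^t and clause voters u_i^j (a c_j-voter), u_i^s (a c_s-voter), u_i^r (a c_r-voter), u_i^t (a c_t-voter); these eight voters are arranged on the cycle (u_i^j, v_i^s, u_i^s, v_i^r, u_i^r, v_i^t, u_i^t, v_i^j), and each of them has as bundle itself together with its two neighbors on this cycle; (2) for each clause f_j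 with exactly two literals, one c_j-voter whose bundle is a singleton; (3) two p-voters w^+, w^− and two d-voters v^+, v^−, with κ(w^+) = κ(v^+) = {w^+, v^+} and κ(w^−) = κ(v^−) = {w^−, v^−}. Then κ is symmetric with all bundles of size at most three, and F is satisfiable if and only if there exists a set V' of at most 2n voters such that p is a Plurality winner of (C, V ∖ κ(V')). -/
/-- Candidates of the (2-2)-3SAT reduction: `Sum.inl j` is the clause
candidate c_j, `Sum.inr true` is the preferred candidate p, and
`Sum.inr false` is the original winner d. -/
abbrev Cand8 (m : ℕ) := Fin m ⊕ Bool

/-- Voters of the (2-2)-3SAT reduction: for each variable i the eight voters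
of its cycle (indexed by `Fin 8` in the order u_i^j, v_i^s, u_i^s, v_i^r,
u_i^r, v_i^t, u_i^t, v_i^j), one extra voter per two-literal clause, and the
four voters w^+, w^−, v^+, v^− of the third group (encoded by `Bool × Bool`,
where `(true, b)` is the p-voter w^b and `(false, b)` is the d-voter v^b). -/
abbrev Voter8 (n m : ℕ) (F : Fin m → Finset (Fin n × Bool)) :=
  (Fin n × Fin 8) ⊕ ({j : Fin m // (F j).card = 2} ⊕ (Bool × Bool))

/-- Favorite candidates in the (2-2)-3SAT reduction, where `pos i` are the two
clauses containing the literal x_i and `neg i` the two containing ¬x_i. -/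
def fav8 (n m : ℕ) (F : Fin m → Finset (Fin n × Bool))
    (pos neg : Fin n → Fin m × Fin m) : Voter8 n m F → Cand8 m
  | Sum.inl (i, k) =>
    if k = 0 then Sum.inl (pos i).1
    else if k = 2 then Sum.inl (neg i).1
    else if k = 4 then Sum.inl (pos i).2
    else if k = 6 then Sum.inl (neg i).2
    else Sum.inr false
  | Sum.inr (Sum.inl j) => Sum.inl j.val
  | Sum.inr (Sum.inr (a, _)) => if a then Sum.inr true else Sum.inr false

/-- The bundling function of the (2-2)-3SAT reduction: each cycle voter is
bundled with its two neighbors on the cycle, each two-literal-clause voter is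
a singleton, and w^b is bundled with v^b. -/
def κ8 (n m : ℕ) (F : Fin m → Finset (Fin n × Bool)) :
    Voter8 n m F → Finset (Voter8 n m F)
  | Sum.inl (i, k) => {Sum.inl (i, k - 1), Sum.inl (i, k), Sum.inl (i, k + 1)}
  | Sum.inr (Sum.inl j) => {Sum.inr (Sum.inl j)}
  | Sum.inr (Sum.inr (_, b)) =>
      {Sum.inr (Sum.inr (true, b)), Sum.inr (Sum.inr (false, b))}

theorem mem_κ8_comm {n m : ℕ} {F : Fin m → Finset (Fin n × Bool)} (x y : Voter8 n m F) :
    y ∈ κ8 n m F x ↔ x ∈ κ8 n m F y := by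
  have key : ∀ k l : Fin 8, (l = k - 1 ∨ l = k ∨ l = k + 1) ↔ (k = l - 1 ∨ k = l ∨ k = l + 1) := by
    decide
  rcases x with ⟨i, k⟩ | e | ⟨a, b⟩ <;> rcases y with ⟨i', k'⟩ | e' | ⟨a', b'⟩
  · have := key k k'
    simp only [κ8, Finset.mem_insert, Finset.mem_singleton, Sum.inl.injEq, Prod.mk.injEq]
    by_cases h : i' = i
    · subst h; simpa using this
    · simp [h, Ne.symm h]
  · simp [κ8]
  · simp [κ8]
  · simp [κ8]
  · simp [κ8, eq_comm]
  · simp [κ8]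
  · simp [κ8]
  · simp [κ8]
  · cases a <;> cases a' <;> simp [κ8, eq_comm]

theorem card_κ8_le {n m : ℕ} {F : Fin m → Finset (Fin n × Bool)} (x : Voter8 n m F) :
    (κ8 n m F x).card ≤ 3 := by
  rcases x with ⟨i, k⟩ | e | ⟨a, b⟩
  · exact Finset.card_le_three
  · simp [κ8]
  · exact Finset.card_le_two.trans (by norm_num)

/-- The voters remaining after deleting the bundles of a given set of voters. -/
abbrev remaining {n m : ℕ} {F : Fin m → Finset (Fin n × Bool)} (V' : Finset (Voter8 n m F)) :
    Finset (Voter8 n m F) :=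
  Finset.univ \ V'.biUnion (κ8 n m F)

theorem mem_remaining {n m : ℕ} {F : Fin m → Finset (Fin n × Bool)} {V' : Finset (Voter8 n m F)}
    {x : Voter8 n m F} : x ∈ remaining V' ↔ ∀ y ∈ κ8 n m F x, y ∉ V' := by
  simp only [remaining, Finset.mem_sdiff, Finset.mem_univ, true_and, Finset.mem_biUnion, not_exists,
    not_and, mem_κ8_comm _ x]
  exact ⟨fun h y hy hV => h y hV hy, fun h y hV hy => h y hy hV⟩

/-- The clause voter on the cycle of a variable that corresponds to an occurrence of
a literal in clause `j`. -/
def literalVoter {n m : ℕ} (F : Fin m → Finset (Fin n × Bool)) (pos neg : Fin n → Fin m × Fin m)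
    (j : Fin m) (l : Fin n × Bool) : Voter8 n m F :=
  Sum.inl (l.1, if l.2 then (if j = (pos l.1).1 then 0 else 4)
    else (if j = (neg l.1).1 then 2 else 6))

theorem literalVoter_injective {n m : ℕ} (F : Fin m → Finset (Fin n × Bool))
    (pos neg : Fin n → Fin m × Fin m) (j : Fin m) :
    Function.Injective (literalVoter F pos neg j) := by
  rintro ⟨i, b⟩ ⟨i', b'⟩ h
  simp only [literalVoter, Sum.inl.injEq, Prod.mk.injEq] at h
  obtain ⟨rfl, h⟩ := h
  cases b <;> cases b' <;> simp at h ⊢ <;> split_ifs at h <;> simp at h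

/-- The voters of the third kind for clause `j`: one if the clause has two literals. -/
def paddingVoters {n m : ℕ} (F : Fin m → Finset (Fin n × Bool)) (j : Fin m) :
    Finset (Voter8 n m F) :=
  if h : (F j).card = 2 then {Sum.inr (Sum.inl ⟨j, h⟩)} else ∅

theorem card_add_card_paddingVoters {n m : ℕ} {F : Fin m → Finset (Fin n × Bool)}
    (hsize : ∀ j, 2 ≤ (F j).card ∧ (F j).card ≤ 3) (j : Fin m) :
    (F j).card + (paddingVoters F j).card = 3 := by
  have := hsize j
  unfold paddingVoters
  split_ifs with h
  · simp [h]
  · simp; omega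

theorem mem_paddingVoters {n m : ℕ} {F : Fin m → Finset (Fin n × Bool)} {j : Fin m}
    {x : Voter8 n m F} :
    x ∈ paddingVoters F j ↔ ∃ e : {j : Fin m // (F j).card = 2},
      x = Sum.inr (Sum.inl e) ∧ e.val = j := by
  unfold paddingVoters
  split_ifs with h
  · simp only [Finset.mem_singleton]
    constructor
    · rintro rfl; exact ⟨_, rfl, rfl⟩
    · rintro ⟨e, rfl, rfl⟩; rfl
  · simp only [Finset.notMem_empty, false_iff]
    rintro ⟨e, rfl, rfl⟩
    exact h e.2

section
variable {n m : ℕ} {F : Fin m → Finset (Fin n × Bool)} {pos neg : Fin n → Fin m × Fin m}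

theorem mem_clause_iff
    (hpos : ∀ i, (pos i).1 < (pos i).2 ∧
      Finset.univ.filter (fun j => (i, true) ∈ F j) = {(pos i).1, (pos i).2})
    (hneg : ∀ i, (neg i).1 < (neg i).2 ∧
      Finset.univ.filter (fun j => (i, false) ∈ F j) = {(neg i).1, (neg i).2})
    (i : Fin n) (j : Fin m) :
    ((i, true) ∈ F j ↔ j = (pos i).1 ∨ j = (pos i).2) ∧
    ((i, false) ∈ F j ↔ j = (neg i).1 ∨ j = (neg i).2) := by
  have h1 := Finset.ext_iff.1 (hpos i).2 j
  have h2 := Finset.ext_iff.1 (hneg i).2 j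
  simpa using And.intro h1 h2

theorem fav8_eq_clause_iff
    (hpos : ∀ i, (pos i).1 < (pos i).2 ∧
      Finset.univ.filter (fun j => (i, true) ∈ F j) = {(pos i).1, (pos i).2})
    (hneg : ∀ i, (neg i).1 < (neg i).2 ∧
      Finset.univ.filter (fun j => (i, false) ∈ F j) = {(neg i).1, (neg i).2})
    (j : Fin m) (x : Voter8 n m F) :
    fav8 n m F pos neg x = Sum.inl j ↔
      (∃ l ∈ F j, literalVoter F pos neg j l = x) ∨ x ∈ paddingVoters F j := by
  rw [mem_paddingVoters]
  rcases x with ⟨i, k⟩ | e | ⟨a, b⟩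
  · obtain ⟨h1, h2⟩ := mem_clause_iff hpos hneg i j
    have hp := (hpos i).1.ne
    have hq := (hneg i).1.ne
    have : (∃ l ∈ F j, literalVoter F pos neg j l = Sum.inl (i, k)) ↔
        ((i, true) ∈ F j ∧ (if j = (pos i).1 then 0 else 4) = k) ∨
        ((i, false) ∈ F j ∧ (if j = (neg i).1 then 2 else 6) = k) := by
      constructor
      · rintro ⟨⟨i', b⟩, hl, h⟩
        simp only [literalVoter, Sum.inl.injEq, Prod.mk.injEq] at h
        obtain ⟨rfl, h⟩ := h
        cases b
        · exact Or.inr ⟨hl, by simpa using h⟩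
        · exact Or.inl ⟨hl, by simpa using h⟩
      · rintro (⟨hl, h⟩ | ⟨hl, h⟩)
        · exact ⟨_, hl, by simp [literalVoter, h]⟩
        · exact ⟨_, hl, by simp [literalVoter, h]⟩
    rw [this, h1, h2]
    fin_cases k <;> simp [fav8] <;> grind
  · simp [fav8, literalVoter]
  · cases a <;> simp [fav8, literalVoter]

theorem fav8_cycle_odd {i : Fin n} {k : Fin 8} (hk : k.val % 2 = 1) :
    fav8 n m F pos neg (Sum.inl (i, k)) = Sum.inr false := by
  fin_cases k <;> simp_all [fav8]

theorem mem_remaining_of_cycle {V' : Finset (Voter8 n m F)} {i : Fin n} {k : Fin 8} :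
    (Sum.inl (i, k) : Voter8 n m F) ∈ remaining V' ↔
      Sum.inl (i, k - 1) ∉ V' ∧ Sum.inl (i, k) ∉ V' ∧ Sum.inl (i, k + 1) ∉ V' := by
  rw [mem_remaining]
  simp [κ8]

/-- If `d` does not beat `p`, all `d`-voters on the cycles have been deleted. -/
theorem cycle_odd_notMem_remaining {V' : Finset (Voter8 n m F)}
    (h : ((remaining V').filter (fun v => fav8 n m F pos neg v = Sum.inr false)).card ≤
      ((remaining V').filter (fun v => fav8 n m F pos neg v = Sum.inr true)).card)
    (i : Fin n) (k : Fin 8) (hk : k.val % 2 = 1) :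
    (Sum.inl (i, k) : Voter8 n m F) ∉ remaining V' := by
  intro hx
  let f : Voter8 n m F → Voter8 n m F :=
    Sum.map id (Sum.map id (fun q => (!q.1, q.2)))
  have hf : Function.Injective f := by
    refine Sum.map_injective.2 ⟨Function.injective_id,
      Sum.map_injective.2 ⟨Function.injective_id, ?_⟩⟩
    rintro ⟨a, b⟩ ⟨a', b'⟩ h
    simpa using h
  set P := (remaining V').filter (fun v => fav8 n m F pos neg v = Sum.inr true) with hP
  have hform : ∀ x ∈ P, ∃ b, x = Sum.inr (Sum.inr (true, b)) := by
    intro x hxP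
    have hxp := (Finset.mem_filter.1 hxP).2
    rcases x with ⟨i, k⟩ | e | ⟨a, b⟩
    · simp only [fav8] at hxp
      split_ifs at hxp
      simp at hxp
    · simp [fav8] at hxp
    · cases a
      · simp [fav8] at hxp
      · exact ⟨b, rfl⟩
  have hsub : insert (Sum.inl (i, k)) (P.image f) ⊆
      (remaining V').filter (fun v => fav8 n m F pos neg v = Sum.inr false) := by
    intro y hy
    rcases Finset.mem_insert.1 hy with rfl | hy
    · exact Finset.mem_filter.2 ⟨hx, fav8_cycle_odd hk⟩
    · obtain ⟨x, hxP, rfl⟩ := Finset.mem_image.1 hy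
      obtain ⟨b, rfl⟩ := hform x hxP
      have := mem_remaining.1 (Finset.mem_filter.1 hxP).1
      exact Finset.mem_filter.2 ⟨mem_remaining.2 this, rfl⟩
  have hnot : (Sum.inl (i, k) : Voter8 n m F) ∉ P.image f := by
    intro hmem
    obtain ⟨x, hxP, hxe⟩ := Finset.mem_image.1 hmem
    obtain ⟨b, rfl⟩ := hform x hxP
    simp [f] at hxe
  have hcard := Finset.card_le_card hsub
  rw [Finset.card_insert_of_notMem hnot, Finset.card_image_of_injective _ hf] at hcard
  omega

/-- Two bundles are needed to cover the odd positions of an eight-cycle, and two bundles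
suffice only when centred at opposite even positions. -/
theorem two_le_card_of_covers_odd :
    ∀ T : Finset (Fin 8), (∀ k : Fin 8, k.val % 2 = 1 → k - 1 ∈ T ∨ k ∈ T ∨ k + 1 ∈ T) →
      2 ≤ T.card ∧ (T.card = 2 → T = {0, 4} ∨ T = {2, 6}) := by
  decide +kernel

theorem card_p_remaining_le (V' : Finset (Voter8 n m F)) :
    ((remaining V').filter (fun v => fav8 n m F pos neg v = Sum.inr true)).card ≤ 2 := by
  have hsub : (remaining V').filter (fun v => fav8 n m F pos neg v = Sum.inr true) ⊆
      {Sum.inr (Sum.inr (true, true)), Sum.inr (Sum.inr (true, false))} := by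
    intro x hx
    have hxp := (Finset.mem_filter.1 hx).2
    rcases x with ⟨i, k⟩ | e | ⟨a, b⟩
    · simp only [fav8] at hxp
      split_ifs at hxp
      simp at hxp
    · simp [fav8] at hxp
    · cases a
      · simp [fav8] at hxp
      · cases b <;> simp
  exact (Finset.card_le_card hsub).trans Finset.card_le_two

theorem satisfiable_of_deletion
    (hsize : ∀ j, 2 ≤ (F j).card ∧ (F j).card ≤ 3)
    (hpos : ∀ i, (pos i).1 < (pos i).2 ∧
      Finset.univ.filter (fun j => (i, true) ∈ F j) = {(pos i).1, (pos i).2})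
    (hneg : ∀ i, (neg i).1 < (neg i).2 ∧
      Finset.univ.filter (fun j => (i, false) ∈ F j) = {(neg i).1, (neg i).2})
    {V' : Finset (Voter8 n m F)} (hV : V'.card ≤ 2 * n)
    (hwin : ∀ c : Cand8 m,
      ((remaining V').filter (fun v => fav8 n m F pos neg v = c)).card ≤
      ((remaining V').filter (fun v => fav8 n m F pos neg v = Sum.inr true)).card) :
    ∃ σ : Fin n → Bool, ∀ j : Fin m, ∃ l ∈ F j, σ l.1 = l.2 := by
  let T : Fin n → Finset (Fin 8) := fun i =>
    Finset.univ.filter (fun k => (Sum.inl (i, k) : Voter8 n m F) ∈ V')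
  have hT : ∀ i k, k ∈ T i ↔ (Sum.inl (i, k) : Voter8 n m F) ∈ V' := by simp [T]
  have hcov := fun i => two_le_card_of_covers_odd (T i) (fun k hk => by
    have := cycle_odd_notMem_remaining (hwin (Sum.inr false)) i k hk
    rw [mem_remaining_of_cycle] at this
    simp only [hT]
    tauto)
  have hinj : Function.Injective
      (fun s : (Σ _ : Fin n, Fin 8) => (Sum.inl (s.1, s.2) : Voter8 n m F)) := by
    rintro ⟨i, k⟩ ⟨i', k'⟩ h
    simpa using h
  set U : Finset (Voter8 n m F) :=
    (Finset.univ.sigma T).image (fun s => Sum.inl (s.1, s.2)) with hU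
  have hUV : U ⊆ V' := by
    intro x hx
    obtain ⟨⟨i, k⟩, hs, rfl⟩ := Finset.mem_image.1 hx
    exact (hT i k).1 (Finset.mem_sigma.1 hs).2
  have hUcard : U.card = ∑ i, (T i).card := by
    rw [hU, Finset.card_image_of_injective _ hinj, Finset.card_sigma]
  have hsum : ∑ _i : Fin n, 2 ≤ ∑ i, (T i).card := Finset.sum_le_sum fun i _ => (hcov i).1
  have hconst : ∑ _i : Fin n, 2 = 2 * n := by simp [mul_comm]
  have hUVc := Finset.card_le_card hUV
  have hUeq : U = V' := Finset.eq_of_subset_of_card_le hUV (by omega)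
  have htwo : ∀ i, 2 = (T i).card := fun i =>
    (Finset.sum_eq_sum_iff_of_le (fun i _ => (hcov i).1)).1 (by omega) i (Finset.mem_univ i)
  have hcases := fun i => (hcov i).2 (htwo i).symm
  have hinr : ∀ y, (Sum.inr y : Voter8 n m F) ∉ V' := by
    intro y hy
    rw [← hUeq, hU] at hy
    simp at hy
  refine ⟨fun i => decide (T i = {0, 4}), fun j => ?_⟩
  by_contra! hfalse
  have hsub : (F j).image (literalVoter F pos neg j) ∪ paddingVoters F j ⊆
      (remaining V').filter (fun v => fav8 n m F pos neg v = Sum.inl j) := by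
    intro x hx
    rw [Finset.mem_union, Finset.mem_image] at hx
    refine Finset.mem_filter.2 ⟨?_, (fav8_eq_clause_iff hpos hneg j x).2 hx⟩
    rcases hx with ⟨⟨i, b⟩, hl, rfl⟩ | hx
    · have hne := hfalse _ hl
      have hc := hcases i
      rw [literalVoter, mem_remaining_of_cycle]
      simp only [← hT]
      cases b
      · have hTi : T i = {0, 4} := by simpa using hne
        rw [hTi]
        simp only [Bool.false_eq_true, if_false]
        split_ifs <;> decide
      · have hTi : T i = {2, 6} := hc.resolve_left (by simpa using hne)
        rw [hTi]
        simp only [if_true]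
        split_ifs <;> decide
    · obtain ⟨e, rfl, -⟩ := mem_paddingVoters.1 hx
      rw [mem_remaining]
      simp [κ8, hinr]
  have hdisj : Disjoint ((F j).image (literalVoter F pos neg j)) (paddingVoters F j) := by
    rw [Finset.disjoint_left]
    intro x hx hx'
    obtain ⟨l, -, rfl⟩ := Finset.mem_image.1 hx
    obtain ⟨e, he, -⟩ := mem_paddingVoters.1 hx'
    simp [literalVoter] at he
  have hcard := Finset.card_le_card hsub
  rw [Finset.card_union_of_disjoint hdisj,
    Finset.card_image_of_injective _ (literalVoter_injective F pos neg j),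
    card_add_card_paddingVoters hsize] at hcard
  have := hwin (Sum.inl j)
  have := card_p_remaining_le (pos := pos) (neg := neg) V'
  omega

theorem deletion_of_satisfiable
    (hsize : ∀ j, 2 ≤ (F j).card ∧ (F j).card ≤ 3)
    (hpos : ∀ i, (pos i).1 < (pos i).2 ∧
      Finset.univ.filter (fun j => (i, true) ∈ F j) = {(pos i).1, (pos i).2})
    (hneg : ∀ i, (neg i).1 < (neg i).2 ∧
      Finset.univ.filter (fun j => (i, false) ∈ F j) = {(neg i).1, (neg i).2})
    (σ : Fin n → Bool) (hσ : ∀ j : Fin m, ∃ l ∈ F j, σ l.1 = l.2) :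
    ∃ V' : Finset (Voter8 n m F), V'.card ≤ 2 * n ∧ ∀ c : Cand8 m,
      ((remaining V').filter (fun v => fav8 n m F pos neg v = c)).card ≤
      ((remaining V').filter (fun v => fav8 n m F pos neg v = Sum.inr true)).card := by
  let T : Bool → Finset (Fin 8) := fun b => if b then {0, 4} else {2, 6}
  let V' : Finset (Voter8 n m F) := (Finset.univ.sigma (fun i => T (σ i))).image
    (fun s : (Σ _ : Fin n, Fin 8) => (Sum.inl (s.1, s.2) : Voter8 n m F))
  have hmem : ∀ i k, (Sum.inl (i, k) : Voter8 n m F) ∈ V' ↔ k ∈ T (σ i) := by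
    simp [V', Sigma.exists]
  have hinr : ∀ y, (Sum.inr y : Voter8 n m F) ∉ V' := by simp [V']
  have hcard : V'.card ≤ 2 * n := by
    have hTc : ∀ b, (T b).card = 2 := by decide
    refine Finset.card_image_le.trans ?_
    simp [Finset.card_sigma, hTc, mul_comm]
  have hp : 2 ≤ ((remaining V').filter (fun v => fav8 n m F pos neg v = Sum.inr true)).card := by
    have hsub : {Sum.inr (Sum.inr (true, true)), Sum.inr (Sum.inr (true, false))} ⊆
        (remaining V').filter (fun v => fav8 n m F pos neg v = Sum.inr true) := by
      intro x hx
      simp only [Finset.mem_insert, Finset.mem_singleton] at hx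
      rw [Finset.mem_filter, mem_remaining]
      rcases hx with rfl | rfl <;> simp [κ8, hinr, fav8]
    refine le_trans ?_ (Finset.card_le_card hsub)
    rw [Finset.card_pair (by simp)]
  refine ⟨V', hcard, ?_⟩
  rintro (j | b)
  · obtain ⟨l, hl, hlσ⟩ := hσ j
    have hsub : (remaining V').filter (fun v => fav8 n m F pos neg v = Sum.inl j) ⊆
        ((F j).erase l).image (literalVoter F pos neg j) ∪ paddingVoters F j := by
      intro x hx
      obtain ⟨hxr, hxf⟩ := Finset.mem_filter.1 hx
      rw [Finset.mem_union, Finset.mem_image]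
      refine ((fav8_eq_clause_iff hpos hneg j x).1 hxf).imp_left ?_
      rintro ⟨l', hl', rfl⟩
      refine ⟨l', Finset.mem_erase.2 ⟨?_, hl'⟩, rfl⟩
      rintro rfl
      refine (mem_remaining_of_cycle.1 hxr).2.1 ((hmem _ _).2 ?_)
      rw [hlσ]
      cases l'.2
      · simp only [Bool.false_eq_true, if_false]
        split_ifs <;> simp [T]
      · simp only [if_true]
        split_ifs <;> simp [T]
    have h1 := Finset.card_le_card hsub
    have h2 := Finset.card_union_le (((F j).erase l).image (literalVoter F pos neg j))
      (paddingVoters F j)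
    have h3 := Finset.card_image_le (s := (F j).erase l) (f := literalVoter F pos neg j)
    have h4 := Finset.card_erase_of_mem hl
    have h5 := card_add_card_paddingVoters hsize j
    have h6 := hsize j
    omega
  · cases b
    · refine le_trans ?_ hp
      have hsub : (remaining V').filter (fun v => fav8 n m F pos neg v = Sum.inr false) ⊆
          {Sum.inr (Sum.inr (false, true)), Sum.inr (Sum.inr (false, false))} := by
        intro x hx
        obtain ⟨hxr, hxf⟩ := Finset.mem_filter.1 hx
        rcases x with ⟨i, k⟩ | e | ⟨a, b⟩
        · rw [mem_remaining_of_cycle, hmem, hmem, hmem] at hxr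
          have hcov : ∀ (b : Bool) (k : Fin 8), k.val % 2 = 1 →
              ¬ (k - 1 ∉ T b ∧ k ∉ T b ∧ k + 1 ∉ T b) := by decide
          have hodd : k.val % 2 = 1 := by
            fin_cases k <;> simp_all [fav8]
          exact absurd hxr (hcov _ _ hodd)
        · simp [fav8] at hxf
        · cases a
          · cases b <;> simp
          · simp [fav8] at hxf
      exact (Finset.card_le_card hsub).trans Finset.card_le_two
    · exact le_rfl

end

/-- (2-2)-3SAT reduction for C-Cons-Del: κ is symmetric with bundles of size
at most three, and F is satisfiable iff at most 2n voters can be deleted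
(together with their bundles) so that p becomes a Plurality winner. -/
theorem stmt_8 (n m : ℕ) (hn : 1 ≤ n)
    (F : Fin m → Finset (Fin n × Bool))
    (hsize : ∀ j, 2 ≤ (F j).card ∧ (F j).card ≤ 3)
    (hpos2 : ∀ i : Fin n, (Finset.univ.filter (fun j => (i, true) ∈ F j)).card = 2)
    (hneg2 : ∀ i : Fin n, (Finset.univ.filter (fun j => (i, false) ∈ F j)).card = 2)
    (pos neg : Fin n → Fin m × Fin m)
    (hpos : ∀ i, (pos i).1 < (pos i).2 ∧
      Finset.univ.filter (fun j => (i, true) ∈ F j) = {(pos i).1, (pos i).2})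
    (hneg : ∀ i, (neg i).1 < (neg i).2 ∧
      Finset.univ.filter (fun j => (i, false) ∈ F j) = {(neg i).1, (neg i).2}) :
    (∀ x y : Voter8 n m F, y ∈ κ8 n m F x ↔ x ∈ κ8 n m F y) ∧
    (∀ x, (κ8 n m F x).card ≤ 3) ∧
    ((∃ σ : Fin n → Bool, ∀ j : Fin m, ∃ l ∈ F j, σ l.1 = l.2) ↔
     (∃ V' : Finset (Voter8 n m F), V'.card ≤ 2 * n ∧
       ∀ c : Cand8 m,
         ((Finset.univ \ V'.biUnion (κ8 n m F)).filter
           (fun v => fav8 n m F pos neg v = c)).card ≤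
         ((Finset.univ \ V'.biUnion (κ8 n m F)).filter
           (fun v => fav8 n m F pos neg v = Sum.inr true)).card)) := by
  exact ⟨mem_κ8_comm, card_κ8_le,
    fun ⟨σ, hσ⟩ => deletion_of_satisfiable hsize hpos hneg σ hσ,
    fun ⟨_, hV, hwin⟩ => satisfiable_of_deletion hsize hpos hneg hV hwin⟩
end

section
/- Let W = {w_1, …, w_N} be voters, each with favorite candidate in {p, g}, and let κ be the symmetric bundling function whose bundling graph is the path w_1 − w_2 − ⋯ − w_N, i.e., κ(w_i) = {w_{i−1}, w_i, w_{i+1}} ∩ W. If W' is a nonempty maximum (s,t)-proper-subset with max{i : w_i ∈ κ(W')} − min{i : w_i ∈ κ(W')} + 1 > 9, then there exists j with s < j < t, an (s,j)-proper-subset W_1 and a (j+1,t)-proper-subset W_2 such that |W_1| + |W_2| ≤ |W'| and κ(W_1 ∪ W_2) = κ(W'). -/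
/-- The path bundling function on voters w_1, …, w_N (modelled by their
indices): κ(w_i) = {w_{i−1}, w_i, w_{i+1}} ∩ W. -/
def bun (N : ℕ) (i : ℕ) : Finset ℕ :=
  ({i - 1, i, i + 1} : Finset ℕ) ∩ Finset.Icc 1 N

/-- κ(W') = ⋃_{w ∈ W'} κ(w). -/
def bunU (N : ℕ) (W' : Finset ℕ) : Finset ℕ := W'.biUnion (bun N)

/-- W(s,t) = {w_i : s ≤ i ≤ t}. -/
def wst (N s t : ℕ) : Finset ℕ := Finset.Icc s t ∩ Finset.Icc 1 N

/-- gap(W') = s_p(κ(W')) − s_g(κ(W')). -/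
def gap {C : Type*} [DecidableEq C] (N : ℕ) (fav : ℕ → C) (p g : C)
    (W' : Finset ℕ) : ℤ :=
  (((bunU N W').filter (fun i => fav i = p)).card : ℤ) -
    (((bunU N W').filter (fun i => fav i = g)).card : ℤ)

/-- An (s,t)-proper-subset: W' ⊆ W(s,t) with κ(W') ⊆ W(s,t). -/
def ProperSubset (N s t : ℕ) (W' : Finset ℕ) : Prop :=
  W' ⊆ wst N s t ∧ bunU N W' ⊆ wst N s t

/-- A maximum (s,t)-proper-subset: an (s,t)-proper-subset whose gap is largest
among all (s,t)-proper-subsets of the same cardinality. -/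
def MaxProperSubset {C : Type*} [DecidableEq C] (N : ℕ) (fav : ℕ → C) (p g : C)
    (s t : ℕ) (W' : Finset ℕ) : Prop :=
  ProperSubset N s t W' ∧
    ∀ W'' : Finset ℕ, ProperSubset N s t W'' → W''.card = W'.card →
      gap N fav p g W'' ≤ gap N fav p g W'

theorem mem_bunU {N : ℕ} {S : Finset ℕ} {y : ℕ} :
    y ∈ bunU N S ↔ ∃ x ∈ S, (y = x - 1 ∨ y = x ∨ y = x + 1) ∧ 1 ≤ y ∧ y ≤ N := by
  simp [bunU, bun]

theorem mem_wst {N s t y : ℕ} :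
    y ∈ wst N s t ↔ (s ≤ y ∧ y ≤ t) ∧ 1 ≤ y ∧ y ≤ N := by
  simp [wst]

theorem bunU_union (N : ℕ) (S T : Finset ℕ) :
    bunU N (S ∪ T) = bunU N S ∪ bunU N T :=
  Finset.union_biUnion

theorem card_bunU_le (N : ℕ) (S : Finset ℕ) : (bunU N S).card ≤ S.card * 3 :=
  Finset.card_biUnion_le_card_mul _ _ _ fun _ _ =>
    (Finset.card_le_card Finset.inter_subset_left).trans Finset.card_le_three

/-- A bundle missing an interior index splits at that index. -/
theorem ProperSubset.split_of_notMem {N s t m : ℕ} {S : Finset ℕ}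
    (hS : ProperSubset N s t S) (hmN : 1 ≤ m ∧ m ≤ N) (hm : m ∉ bunU N S) :
    ProperSubset N s m (S.filter (· < m)) ∧
      ProperSubset N (m + 1) t (S.filter (¬ · < m)) := by
  have key : ∀ x ∈ S, x + 1 < m ∨ m + 1 < x := by
    intro x hx
    by_contra h
    exact hm (mem_bunU.2 ⟨x, hx, by omega, hmN⟩)
  refine ⟨⟨fun x hx => ?_, fun y hy => ?_⟩, ⟨fun x hx => ?_, fun y hy => ?_⟩⟩
  · rw [Finset.mem_filter] at hx
    have := mem_wst.1 (hS.1 hx.1)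
    exact mem_wst.2 (by omega)
  · obtain ⟨x, hx, hxy⟩ := mem_bunU.1 hy
    rw [Finset.mem_filter] at hx
    have := mem_wst.1 (hS.2 (mem_bunU.2 ⟨x, hx.1, hxy⟩))
    exact mem_wst.2 (by have := key x hx.1; omega)
  · rw [Finset.mem_filter] at hx
    have := mem_wst.1 (hS.1 hx.1)
    exact mem_wst.2 (by have := key x hx.1; omega)
  · obtain ⟨x, hx, hxy⟩ := mem_bunU.1 hy
    rw [Finset.mem_filter] at hx
    have := mem_wst.1 (hS.2 (mem_bunU.2 ⟨x, hx.1, hxy⟩))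
    exact mem_wst.2 (by have := key x hx.1; omega)

/-- An interval of at least three and at most `3 * k` voters is the bundle of at most `k`
of its members. -/
theorem exists_bunU_eq_Icc {N a b k : ℕ} (ha : 1 ≤ a) (hb : b ≤ N) (hab : a + 2 ≤ b)
    (hk : b + 1 ≤ a + 3 * k) :
    ∃ S ⊆ Finset.Icc a b, S.card ≤ k ∧ bunU N S = Finset.Icc a b := by
  refine ⟨(Finset.range k).image fun i => min (a + 1 + 3 * i) (b - 1), ?_,
    Finset.card_image_le.trans (Finset.card_range k).le, ?_⟩
  · intro x hx
    obtain ⟨i, -, rfl⟩ := Finset.mem_image.1 hx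
    exact Finset.mem_Icc.2 (by omega)
  · ext y
    rw [mem_bunU, Finset.mem_Icc]
    constructor
    · rintro ⟨x, hx, hxy⟩
      obtain ⟨i, -, rfl⟩ := Finset.mem_image.1 hx
      omega
    · intro hy
      refine ⟨_, Finset.mem_image.2 ⟨(y - a) / 3, Finset.mem_range.2 (by omega), rfl⟩, ?_⟩
      omega

/-- Splitting claim: a nonempty maximum (s,t)-proper-subset whose bundle spans
more than 9 indices splits at some j with s < j < t into an (s,j)- and a
(j+1,t)-proper-subset covering the same bundle with no more voters. -/
theorem stmt_9 {C : Type*} [DecidableEq C] (N : ℕ) (fav : ℕ → C)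
    (p g : C) (hpg : p ≠ g)
    (hfav : ∀ i ∈ Finset.Icc 1 N, fav i = p ∨ fav i = g)
    (s t : ℕ) (W' : Finset ℕ)
    (hmax : MaxProperSubset N fav p g s t W')
    (hW'ne : W'.Nonempty)
    (hne : (bunU N W').Nonempty)
    (hbig : 9 < (bunU N W').max' hne - (bunU N W').min' hne + 1) :
    ∃ j, s < j ∧ j < t ∧ ∃ W₁ W₂ : Finset ℕ,
      ProperSubset N s j W₁ ∧ ProperSubset N (j + 1) t W₂ ∧
      W₁.card + W₂.card ≤ W'.card ∧ bunU N (W₁ ∪ W₂) = bunU N W' := by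
  obtain ⟨hS, -⟩ := hmax
  set a := (bunU N W').min' hne
  set b := (bunU N W').max' hne
  have haB : a ∈ bunU N W' := Finset.min'_mem _ _
  have hbB : b ∈ bunU N W' := Finset.max'_mem _ _
  have ha := mem_wst.1 (hS.2 haB)
  have hb := mem_wst.1 (hS.2 hbB)
  by_cases hcon : Finset.Icc a b ⊆ bunU N W'
  · have hB : bunU N W' = Finset.Icc a b :=
      (Finset.subset_iff.2 fun y hy =>
        Finset.mem_Icc.2 ⟨Finset.min'_le _ _ hy, Finset.le_max' _ _ hy⟩).antisymm hcon
    have hcard := card_bunU_le N W'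
    rw [hB, Nat.card_Icc] at hcard
    obtain ⟨S₁, hS₁, hc₁, hB₁⟩ :=
      exists_bunU_eq_Icc (N := N) (a := a) (b := a + 2) (k := 1)
        (by omega) (by omega) (by omega) (by omega)
    obtain ⟨S₂, hS₂, hc₂, hB₂⟩ :=
      exists_bunU_eq_Icc (N := N) (a := a + 3) (b := b) (k := W'.card - 1)
        (by omega) (by omega) (by omega) (by omega)
    have h₁ : Finset.Icc a (a + 2) ⊆ wst N s (a + 2) := fun y hy =>
      mem_wst.2 (by rw [Finset.mem_Icc] at hy; omega)
    have h₂ : Finset.Icc (a + 3) b ⊆ wst N (a + 2 + 1) t := fun y hy =>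
      mem_wst.2 (by rw [Finset.mem_Icc] at hy; omega)
    refine ⟨a + 2, by omega, by omega, S₁, S₂, ⟨hS₁.trans h₁, hB₁ ▸ h₁⟩,
      ⟨hS₂.trans h₂, hB₂ ▸ h₂⟩, by omega, ?_⟩
    rw [bunU_union, hB₁, hB₂, hB]
    ext y
    simp only [Finset.mem_union, Finset.mem_Icc]
    omega
  · obtain ⟨m, hm, hmB⟩ := Finset.not_subset.1 hcon
    rw [Finset.mem_Icc] at hm
    have hma : m ≠ a := fun h => hmB (h ▸ haB)
    have hmb : m ≠ b := fun h => hmB (h ▸ hbB)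
    obtain ⟨h₁, h₂⟩ := hS.split_of_notMem (by omega) hmB
    refine ⟨m, by omega, by omega, _, _, h₁, h₂,
      (Finset.card_filter_add_card_filter_not _).le, ?_⟩
    rw [Finset.filter_union_filter_not_eq]
end

section
/- Let G be a finite simple undirected graph with vertex set {u_1, …, u_n}, let Δ be its maximum degree, and let h ∈ ℕ. Consider the election with candidates C = {p, g_1, …, g_n} and the following voters: (1) for each vertex u_i, a bundle B_i containing, for each u_j ∈ N[u_i], one g_j-voter, where every voter of B_i has bundle B_i; (2) one further bundle D containing Δ p-voters and, for each vertex u_i, exactly Δ + 1 − |N[u_i]| additional g_i-voters, where every voter of D has bundle D. Then κ is disjoint, and G has a dominating set of size at most h if and only if there exists V' ⊆ V with |V'| ≤ h such that p is a Plurality winner of (C, V ∖ κ(V')). -/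
/-- Group-1 voters of the Dominating Set reduction for C-Cons-Del: for each
vertex u_i, the bundle B_i contains one g_j-voter for each u_j ∈ N[u_i];
voter `⟨(i, j), _⟩` is the g_j-voter of bundle B_i. -/
abbrev B12 {V : Type*} [Fintype V] [DecidableEq V]
    (G : SimpleGraph V) [DecidableRel G.Adj] :=
  {x : V × V // x.2 ∈ insert x.1 (G.neighborFinset x.1)}

/-- Group-2 voters (the bundle D): Δ p-voters along with, for each vertex u_i,
Δ + 1 − |N[u_i]| further g_i-voters. -/
abbrev D12 {V : Type*} [Fintype V] [DecidableEq V]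
    (G : SimpleGraph V) [DecidableRel G.Adj] :=
  Fin G.maxDegree ⊕
    (Σ i : V, Fin (G.maxDegree + 1 - (insert i (G.neighborFinset i)).card))

/-- All voters of the Dominating Set reduction. -/
abbrev Voter12 {V : Type*} [Fintype V] [DecidableEq V]
    (G : SimpleGraph V) [DecidableRel G.Adj] :=
  B12 G ⊕ D12 G

/-- Favorite candidates: `none` is the preferred candidate p and `some u` is
the vertex candidate g_u. -/
def fav12 {V : Type*} [Fintype V] [DecidableEq V]
    (G : SimpleGraph V) [DecidableRel G.Adj] : Voter12 G → Option V :=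
  Sum.elim (fun x => some x.val.2) (Sum.elim (fun _ => none) (fun y => some y.1))

open Finset in
theorem card_filter_fav12 {V : Type*} [Fintype V] [DecidableEq V]
    (G : SimpleGraph V) [DecidableRel G.Adj] (S : Finset (Voter12 G)) (c : Option V) :
    ((univ \ S).filter (fun v => fav12 G v = c)).card =
      (univ.filter (fun x : B12 G => Sum.inl x ∉ S ∧ some x.val.2 = c)).card +
      ((univ.filter (fun i : Fin G.maxDegree =>
          (Sum.inr (Sum.inl i) : Voter12 G) ∉ S ∧ none = c)).card +
        (univ.filter (fun y : Σ i : V,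
            Fin (G.maxDegree + 1 - (insert i (G.neighborFinset i)).card) =>
          (Sum.inr (Sum.inr y) : Voter12 G) ∉ S ∧ some y.1 = c)).card) := by
  have h : (univ \ S).filter (fun v => fav12 G v = c) =
      univ.filter (fun v => v ∉ S ∧ fav12 G v = c) := by
    ext; simp
  rw [h]
  simp only [card_filter, Fintype.sum_sum_type]
  rfl

open Finset in
theorem card_B12_favoring {V : Type*} [Fintype V] [DecidableEq V]
    (G : SimpleGraph V) [DecidableRel G.Adj] (S : Finset (Voter12 G)) (A : Finset V)
    (hA : ∀ x : B12 G, Sum.inl x ∈ S ↔ x.val.1 ∈ A) (v : V) :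
    (univ.filter (fun x : B12 G => Sum.inl x ∉ S ∧ some x.val.2 = some v)).card =
      (insert v (G.neighborFinset v) \ A).card := by
  refine card_bij (fun x _ => x.val.1) ?_ ?_ ?_
  · rintro ⟨⟨a, b⟩, hx⟩ hm
    simp only [mem_filter, hA, mem_univ, true_and, Option.some.injEq] at hm
    obtain ⟨h1, rfl⟩ := hm
    simp only [mem_insert, SimpleGraph.mem_neighborFinset] at hx
    simp only [mem_sdiff, mem_insert, SimpleGraph.mem_neighborFinset]
    exact ⟨hx.imp Eq.symm SimpleGraph.Adj.symm, h1⟩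
  · rintro ⟨⟨a, b⟩, hx⟩ hm ⟨⟨a', b'⟩, hx'⟩ hm' h
    simp only [mem_filter, hA, mem_univ, true_and, Option.some.injEq] at hm hm' h
    obtain ⟨-, rfl⟩ := hm
    obtain ⟨-, rfl⟩ := hm'
    subst h
    rfl
  · intro a ha
    simp only [mem_sdiff, mem_insert, SimpleGraph.mem_neighborFinset] at ha
    refine ⟨⟨(a, v), ?_⟩, ?_, rfl⟩
    · simp only [mem_insert, SimpleGraph.mem_neighborFinset]
      exact ha.1.imp Eq.symm SimpleGraph.Adj.symm
    · simp [hA, ha.2]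

theorem card_fst_eq {V : Type*} [Fintype V] [DecidableEq V] (f : V → ℕ) (v : V) :
    (Finset.univ.filter (fun y : Σ i : V, Fin (f i) => y.1 = v)).card = f v := by
  rw [Finset.card_filter, Fintype.sum_sigma]
  simp [apply_ite Finset.card]

/-- Scores when the bundles of `A` are deleted and the bundle `D` is kept. -/
theorem scores_of_D12_kept {V : Type*} [Fintype V] [DecidableEq V]
    (G : SimpleGraph V) [DecidableRel G.Adj] (S : Finset (Voter12 G)) (A : Finset V)
    (hA : ∀ x : B12 G, Sum.inl x ∈ S ↔ x.val.1 ∈ A) (hD : ∀ d : D12 G, Sum.inr d ∉ S) :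
    ((Finset.univ \ S).filter (fun v => fav12 G v = none)).card = G.maxDegree ∧
    ∀ v, ((Finset.univ \ S).filter (fun w => fav12 G w = some v)).card =
      (insert v (G.neighborFinset v) \ A).card +
        (G.maxDegree + 1 - (insert v (G.neighborFinset v)).card) := by
  refine ⟨?_, fun v => ?_⟩
  · rw [card_filter_fav12]
    simp [hD]
  · rw [card_filter_fav12, card_B12_favoring G S A hA]
    have := card_fst_eq
      (fun i => G.maxDegree + 1 - (insert i (G.neighborFinset i)).card) v
    simp only [hD, not_false_eq_true, true_and, Option.some.injEq, reduceCtorEq,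
      Finset.filter_false, Finset.card_empty, zero_add, this]

/-- Scores when the bundles of `A` and the bundle `D` are deleted. -/
theorem scores_of_D12_deleted {V : Type*} [Fintype V] [DecidableEq V]
    (G : SimpleGraph V) [DecidableRel G.Adj] (S : Finset (Voter12 G)) (A : Finset V)
    (hA : ∀ x : B12 G, Sum.inl x ∈ S ↔ x.val.1 ∈ A) (hD : ∀ d : D12 G, Sum.inr d ∈ S) :
    ((Finset.univ \ S).filter (fun v => fav12 G v = none)).card = 0 ∧
    ∀ v, ((Finset.univ \ S).filter (fun w => fav12 G w = some v)).card =
      (insert v (G.neighborFinset v) \ A).card := by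
  refine ⟨?_, fun v => ?_⟩
  · rw [card_filter_fav12]
    simp [hD]
  · rw [card_filter_fav12, card_B12_favoring G S A hA]
    simp [hD]

theorem card_insert_neighborFinset_le {V : Type*} [Fintype V] [DecidableEq V]
    (G : SimpleGraph V) [DecidableRel G.Adj] (v : V) :
    (insert v (G.neighborFinset v)).card ≤ G.maxDegree + 1 :=
  (Finset.card_insert_le _ _).trans (Nat.succ_le_succ (G.degree_le_maxDegree v))

/-- Dominating Set reduction for C-Cons-Del with disjoint bundles: every voter
of B_i has bundle B_i, every voter of D has bundle D; κ is disjoint, and G has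
a dominating set of size ≤ h iff deleting at most h bundles makes p a
Plurality winner. -/
theorem stmt_12 {V : Type*} [Fintype V] [DecidableEq V]
    (G : SimpleGraph V) [DecidableRel G.Adj]
    (h : ℕ)
    (κ : Voter12 G → Finset (Voter12 G))
    (hκ1 : ∀ x : B12 G, κ (Sum.inl x) =
      (Finset.univ.filter (fun y : B12 G => y.val.1 = x.val.1)).image Sum.inl)
    (hκ2 : ∀ d : D12 G, κ (Sum.inr d) = (Finset.univ : Finset (D12 G)).image Sum.inr) :
    (∀ x y, κ x = κ y ∨ κ x ∩ κ y = ∅) ∧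
    ((∃ U : Finset V, U.card ≤ h ∧
        ∀ v : V, ∃ u ∈ U, v ∈ insert u (G.neighborFinset u)) ↔
     (∃ V' : Finset (Voter12 G), V'.card ≤ h ∧
       ∀ c : Option V,
         ((Finset.univ \ V'.biUnion κ).filter (fun v => fav12 G v = c)).card ≤
         ((Finset.univ \ V'.biUnion κ).filter (fun v => fav12 G v = none)).card)) := by
  refine ⟨?_, ?_, ?_⟩
  · rintro (x | d) (y | e)
    · by_cases hxy : x.val.1 = y.val.1
      · left; rw [hκ1, hκ1, hxy]
      · right
        rw [hκ1, hκ1]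
        ext z
        simp only [Finset.mem_inter, Finset.mem_image, Finset.mem_filter, Finset.mem_univ,
          true_and, Finset.notMem_empty, iff_false]
        rintro ⟨⟨a, ha, rfl⟩, b, hb, hab⟩
        cases hab
        exact hxy (ha.symm.trans hb)
    · right
      rw [hκ1, hκ2]
      ext z
      simp only [Finset.mem_inter, Finset.mem_image, Finset.notMem_empty, iff_false]
      rintro ⟨⟨a, -, rfl⟩, b, -, hab⟩
      cases hab
    · right
      rw [hκ1, hκ2]
      ext z
      simp only [Finset.mem_inter, Finset.mem_image, Finset.notMem_empty, iff_false]
      rintro ⟨⟨a, -, rfl⟩, b, -, hab⟩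
      cases hab
    · left; rw [hκ2, hκ2]
  · rintro ⟨U, hU, hdom⟩
    let b : V → Voter12 G := fun u => Sum.inl ⟨(u, u), Finset.mem_insert_self _ _⟩
    refine ⟨U.image b, Finset.card_image_le.trans hU, ?_⟩
    obtain ⟨hp, hg⟩ := scores_of_D12_kept G ((U.image b).biUnion κ) U
      (fun x => by simp [b, hκ1]) (fun d => by simp [b, hκ1])
    rintro (_ | v)
    · exact le_rfl
    · rw [hp, hg]
      obtain ⟨u, hu, huv⟩ := hdom v
      have hlt : (insert v (G.neighborFinset v) \ U).card <
          (insert v (G.neighborFinset v)).card := by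
        refine Finset.card_lt_card (Finset.ssubset_iff_subset_ne.2
          ⟨Finset.sdiff_subset, fun he => ?_⟩)
        have hmem : u ∈ insert v (G.neighborFinset v) := by
          simp only [Finset.mem_insert, SimpleGraph.mem_neighborFinset] at huv ⊢
          exact huv.imp Eq.symm SimpleGraph.Adj.symm
        rw [← he] at hmem
        exact (Finset.mem_sdiff.1 hmem).2 hu
      have := card_insert_neighborFinset_le G v
      omega
  · rintro ⟨V', hV', hwin⟩
    let A : Finset V := V'.toLeft.image (fun x => x.val.1)
    have hA : ∀ x : B12 G, Sum.inl x ∈ V'.biUnion κ ↔ x.val.1 ∈ A := by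
      intro x
      simp only [Finset.mem_biUnion, A, Finset.mem_image, Finset.mem_toLeft]
      constructor
      · rintro ⟨y | d, hy, hx⟩
        · rw [hκ1] at hx
          simp only [Finset.mem_image, Finset.mem_filter, Finset.mem_univ, true_and,
            Sum.inl.injEq, exists_eq_right] at hx
          exact ⟨y, hy, hx.symm⟩
        · simp [hκ2] at hx
      · rintro ⟨y, hy, hx⟩
        refine ⟨Sum.inl y, hy, ?_⟩
        rw [hκ1]
        simp only [Finset.mem_image, Finset.mem_filter, Finset.mem_univ, true_and,
          Sum.inl.injEq, exists_eq_right]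
        exact hx.symm
    refine ⟨A, Finset.card_image_le.trans (Finset.card_toLeft_le.trans hV'), fun v => ?_⟩
    by_contra hv
    have hdisj : insert v (G.neighborFinset v) \ A = insert v (G.neighborFinset v) := by
      refine Finset.sdiff_eq_self_of_disjoint (Finset.disjoint_left.2 fun u hu huA => ?_)
      refine hv ⟨u, huA, ?_⟩
      simp only [Finset.mem_insert, SimpleGraph.mem_neighborFinset] at hu ⊢
      exact hu.imp Eq.symm SimpleGraph.Adj.symm
    have hpos : 0 < (insert v (G.neighborFinset v)).card :=
      Finset.card_pos.2 (Finset.insert_nonempty _ _)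
    have hle := card_insert_neighborFinset_le G v
    have hw := hwin (some v)
    by_cases hd : ∃ d : D12 G, Sum.inr d ∈ V'
    · obtain ⟨d, hd⟩ := hd
      obtain ⟨hp, hg⟩ := scores_of_D12_deleted G (V'.biUnion κ) A hA
        (fun e => Finset.mem_biUnion.2 ⟨Sum.inr d, hd, by rw [hκ2]; simp⟩)
      rw [hp, hg, hdisj] at hw
      omega
    · obtain ⟨hp, hg⟩ := scores_of_D12_kept G (V'.biUnion κ) A hA (fun e he => by
        obtain ⟨y | d, hy, hx⟩ := Finset.mem_biUnion.1 he
        · simp [hκ1] at hx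
        · exact hd ⟨d, hy⟩)
      rw [hp, hg, hdisj] at hw
      omega
end

section
/- Let (C, V) be an election with distinguished candidate p ∈ C and let κ be a symmetric bundling function on V with |κ(v)| ≤ 2 for every v ∈ V. Suppose V' ⊆ V is such that p is a Plurality winner of (C, V ∖ κ(V')). Then, for V'' := {v ∈ V' : κ(v) contains no p-voter}, it holds that |V''| ≤ |V'| and p is a Plurality winner of (C, V ∖ κ(V'')). -/
/-- Symmetric bundles of size at most two form a partition. -/
theorem bundle_eq_of_mem {ν : Type*} [DecidableEq ν] {κ : ν → Finset ν}
    (hbundle : ∀ v, v ∈ κ v) (hsym : ∀ x y : ν, y ∈ κ x ↔ x ∈ κ y)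
    (hb : ∀ v, (κ v).card ≤ 2) {x y : ν} (h : y ∈ κ x) : κ x = κ y := by
  by_cases hxy : x = y
  · rw [hxy]
  have eq_pair : ∀ v, x ∈ κ v → y ∈ κ v → {x, y} = κ v := fun v hx hy =>
    Finset.eq_of_subset_of_card_le (by simp [Finset.insert_subset_iff, hx, hy])
      (by rw [Finset.card_pair hxy]; exact hb v)
  rw [← eq_pair x (hbundle x) h, ← eq_pair y ((hsym x y).1 h) (hbundle y)]

/-- Two members of a bundle of size at most two that both differ from a third member agree. -/
theorem eq_of_mem_of_ne_of_card_le_two {ν : Type*} [DecidableEq ν] {s : Finset ν}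
    (hs : s.card ≤ 2) {a b c : ν} (ha : a ∈ s) (hb : b ∈ s) (hc : c ∈ s)
    (hac : a ≠ c) (hbc : b ≠ c) : a = b := by
  by_contra hab
  exact absurd (Finset.two_lt_card.2 ⟨a, ha, b, hb, c, hc, hab, hac, hbc⟩) (by omega)

/-- For symmetric bundling functions with bundles of size at most two:
if deleting the bundles of V' makes p a Plurality winner, then so does deleting
only the bundles of those voters of V' whose bundle contains no p-voter. -/
theorem stmt_13 {ν C : Type*} [Fintype ν] [DecidableEq ν] [DecidableEq C]
    (f : ν → C) (p : C)
    (κ : ν → Finset ν) (hbundle : ∀ v, v ∈ κ v)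
    (hsym : ∀ x y : ν, y ∈ κ x ↔ x ∈ κ y)
    (hb : ∀ v, (κ v).card ≤ 2)
    (V' : Finset ν)
    (hwin : ∀ c : C,
      (((Finset.univ : Finset ν) \ V'.biUnion κ).filter (fun v => f v = c)).card ≤
      (((Finset.univ : Finset ν) \ V'.biUnion κ).filter (fun v => f v = p)).card) :
    (V'.filter (fun v => ∀ w ∈ κ v, f w ≠ p)).card ≤ V'.card ∧
    ∀ c : C,
      (((Finset.univ : Finset ν) \
          (V'.filter (fun v => ∀ w ∈ κ v, f w ≠ p)).biUnion κ).filter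
        (fun v => f v = c)).card ≤
      (((Finset.univ : Finset ν) \
          (V'.filter (fun v => ∀ w ∈ κ v, f w ≠ p)).biUnion κ).filter
        (fun v => f v = p)).card := by
  refine ⟨Finset.card_filter_le _ _, fun c => ?_⟩
  by_cases hcp : c = p
  · rw [hcp]
  have key : ∀ {x y : ν}, y ∈ κ x → κ x = κ y := bundle_eq_of_mem hbundle hsym hb
  set V'' := V'.filter (fun v => ∀ w ∈ κ v, f w ≠ p) with hV''
  set A := (Finset.univ : Finset ν) \ V'.biUnion κ with hA
  set B := (Finset.univ : Finset ν) \ V''.biUnion κ with hB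
  have hAB : A ⊆ B := Finset.sdiff_subset_sdiff subset_rfl
    (Finset.biUnion_subset_biUnion_of_subset_left _ (Finset.filter_subset _ _))
  have hsplit : ∀ d, (B.filter (fun v => f v = d)).card =
      ((B \ A).filter (fun v => f v = d)).card + (A.filter (fun v => f v = d)).card := by
    intro d
    rw [← Finset.card_union_of_disjoint
      (Finset.disjoint_filter_filter Finset.sdiff_disjoint), ← Finset.filter_union,
      Finset.sdiff_union_of_subset hAB]
  have mem_diff : ∀ w, w ∈ B \ A ↔ (∀ u ∈ V'', w ∉ κ u) ∧ ∃ v ∈ V', w ∈ κ v := by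
    intro w
    simp [hA, hB]
  have partner : ∀ w ∈ B \ A, ∃ g ∈ κ w, g ∈ B \ A ∧ f g = p := by
    intro w hw
    rw [mem_diff] at hw
    obtain ⟨hwB, v, hv, hwv⟩ := hw
    have hv'' : v ∉ V'' := fun h => hwB v h hwv
    simp only [hV'', Finset.mem_filter, hv, true_and, not_forall, not_not] at hv''
    obtain ⟨g, hg, hgp⟩ := hv''
    refine ⟨g, key hwv ▸ hg, (mem_diff g).2 ⟨fun u hu hgu => ?_, v, hv, hg⟩, hgp⟩
    exact (Finset.mem_filter.1 hu).2 g hgu hgp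
  choose! g hgκ hgBA hgp using partner
  have hle : ((B \ A).filter (fun v => f v = c)).card ≤
      ((B \ A).filter (fun v => f v = p)).card := by
    refine Finset.card_le_card_of_injOn g (fun w hw => ?_) (fun w hw w' hw' hww => ?_)
    · have hw := (Finset.mem_filter.1 hw).1
      exact Finset.mem_filter.2 ⟨hgBA w hw, hgp w hw⟩
    · obtain ⟨hw, hwc⟩ := Finset.mem_filter.1 hw
      obtain ⟨hw', hwc'⟩ := Finset.mem_filter.1 hw'
      refine eq_of_mem_of_ne_of_card_le_two (hb (g w)) ((hsym _ _).1 (hgκ w hw))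
        (hww ▸ (hsym _ _).1 (hgκ w' hw')) (hbundle _) ?_ ?_
      · intro h
        exact hcp (by rw [← hwc, h, hgp w hw])
      · intro h
        exact hcp (by rw [← hwc', h, hgp w hw])
  rw [hsplit c, hsplit p]
  exact add_le_add hle (hwin c)
end

section
/- Let G = (V(G), E(G)) be a finite simple undirected graph and h ∈ ℕ with h ≥ 4. Consider the election with candidates C = {p, g, x}, registered voters V consisting of h(h−1)/2 p-voters and 2·h(h−1)/2 − h g-voters, and unregistered voters W consisting of: for each vertex u ∈ V(G), one g-voter w_u with κ(w_u) = {w_u}; and for each edge e = {u, u'} ∈ E(G), one p-voter w_e and two x-voters w_e', w_e'' with κ(w_e) = {w_e, w_u, w_{u'}, w_e', w_e''}, κ(w_e') = {w_e'} and κ(w_e'') = {w_e''}. Then G has a clique of size at least h if and only if there exists a subset W' ⊆ W (of arbitrary size) such that p is a Plurality winner of (C, V ∪ κ(W')). -/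
/-- Unregistered voters of the Clique reduction for C-Cons-Add-Unlim: one
g-voter per vertex (singleton bundle) and, per edge e, a p-voter w_e = (e, 0)
bundled with the endpoints' vertex voters and two x-voters (e, 1), (e, 2)
which themselves have singleton bundles. -/
abbrev W15 {V : Type*} [Fintype V] [DecidableEq V]
    (G : SimpleGraph V) [DecidableRel G.Adj] :=
  V ⊕ ({e : Sym2 V // e ∈ G.edgeFinset} × Fin 3)

/-- All voters: registered voters are h(h−1)/2 p-voters and
2·h(h−1)/2 − h g-voters; unregistered voters are `W15 G`. -/
abbrev Voter15 {V : Type*} [Fintype V] [DecidableEq V]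
    (G : SimpleGraph V) [DecidableRel G.Adj] (h : ℕ) :=
  (Fin (h * (h - 1) / 2) ⊕ Fin (2 * (h * (h - 1) / 2) - h)) ⊕ W15 G

open Finset in
theorem card_filter_score15 {V C : Type*} [Fintype V] [DecidableEq V] [DecidableEq C]
    (G : SimpleGraph V) [DecidableRel G.Adj] (p g x c : C) (h : ℕ) (B : Finset (W15 G)) :
    ((((univ : Finset (Fin (h * (h - 1) / 2) ⊕ Fin (2 * (h * (h - 1) / 2) - h))).image
          Sum.inl ∪ B.image Sum.inr : Finset (Voter15 G h))).filter
        (fun v => Sum.elim (Sum.elim (fun _ => p) (fun _ => g))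
          (Sum.elim (fun _ => g) (fun ei => if ei.2 = (0 : Fin 3) then p else x)) v = c)).card =
      ((if p = c then h * (h - 1) / 2 else 0) +
          (if g = c then 2 * (h * (h - 1) / 2) - h else 0)) +
        ((if g = c then #{u : V | Sum.inl u ∈ B} else 0) +
          ((if p = c then #{e : {e // e ∈ G.edgeFinset} | Sum.inr (e, (0 : Fin 3)) ∈ B} else 0) +
            (if x = c then #{e : {e // e ∈ G.edgeFinset} | Sum.inr (e, (1 : Fin 3)) ∈ B} else 0) +
            (if x = c then #{e : {e // e ∈ G.edgeFinset} | Sum.inr (e, (2 : Fin 3)) ∈ B}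
              else 0))) := by
  have key : ∀ (S : Finset (Voter15 G h)) (f : Voter15 G h → C),
      (S.filter (fun v => f v = c)).card = ∑ v, if f v = c then (if v ∈ S then 1 else 0) else 0 := by
    intro S f
    rw [← sum_filter, ← sum_filter, filter_filter, ← card_eq_sum_ones]
    congr 1
    ext v
    simp [and_comm]
  rw [key]
  simp only [Fintype.sum_sum_type, Fintype.sum_prod_type, Fin.sum_univ_three, Sum.elim_inl,
    Sum.elim_inr, sum_add_distrib]
  congr 1
  · by_cases hp : p = c <;> by_cases hg : g = c <;> simp [hp, hg]
  · by_cases hp : p = c <;> by_cases hg : g = c <;> by_cases hx : x = c <;> simp [hp, hg, hx]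

open Finset in
/-- A graph has a clique on `U` as soon as at least `|U| choose 2` of its edges lie inside `U`. -/
theorem adj_of_choose_le_card {V : Type*} [DecidableEq V] (G : SimpleGraph V) (U : Finset V)
    (F : Finset (Sym2 V)) (hF : ∀ e ∈ F, e ∈ G.edgeSet)
    (hsub : F ⊆ U.offDiag.image Sym2.mk.uncurry) (hcard : U.card.choose 2 ≤ F.card) :
    ∀ a ∈ U, ∀ b ∈ U, a ≠ b → G.Adj a b := by
  intro a ha b hb hab
  have heq := eq_of_subset_of_card_le hsub (by rwa [Sym2.card_image_offDiag])
  refine hF s(a, b) (heq ▸ mem_image.2 ⟨(a, b), mem_offDiag.2 ⟨ha, hb, hab⟩, rfl⟩)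

theorem choose_two_tight {h k m : ℕ} (hh : 4 ≤ h) (hm : m ≤ h.choose 2) (hk : m ≤ k.choose 2)
    (hg : h.choose 2 + k ≤ m + h) : k = h ∧ m = h.choose 2 := by
  have hkh : k ≤ h := by omega
  rcases hkh.eq_or_lt with rfl | hlt
  · exact ⟨rfl, by omega⟩
  · exfalso
    obtain ⟨n, rfl⟩ : ∃ n, h = n + 1 := ⟨h - 1, by omega⟩
    have h1 : (n + 1).choose 2 = n + n.choose 2 := by
      rw [Nat.choose_succ_succ' n 1, Nat.choose_one_right]
    have h2 : n.choose 2 + k ≤ k.choose 2 + 1 := by omega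
    have h3 := Nat.choose_le_choose 2 (Nat.lt_succ_iff.1 hlt)
    have h4 : 3 ≤ n.choose 2 := Nat.choose_le_choose 2 (show 3 ≤ n by omega)
    have h5 : k ≤ 1 := by omega
    interval_cases k <;> simp at h2 <;> omega

/-- Clique reduction for C-Cons-Add with unlimited budget and three candidates
p, g, x: G has a clique of size at least h iff some subset W' of unregistered
voters (of arbitrary size) makes p a Plurality winner of (C, V ∪ κ(W')). -/
theorem stmt_15 {V C : Type*} [Fintype V] [DecidableEq V] [DecidableEq C]
    (G : SimpleGraph V) [DecidableRel G.Adj]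
    (p g x : C) (hpg : p ≠ g) (hpx : p ≠ x) (hgx : g ≠ x)
    (h : ℕ) (hh : 4 ≤ h)
    (κ : W15 G → Finset (W15 G))
    (hκ1 : ∀ u : V, κ (Sum.inl u) = {Sum.inl u})
    (hκ2 : ∀ e : {e : Sym2 V // e ∈ G.edgeFinset},
      κ (Sum.inr (e, (0 : Fin 3))) =
        insert (Sum.inr (e, (0 : Fin 3)))
          (insert (Sum.inr (e, (1 : Fin 3)))
            (insert (Sum.inr (e, (2 : Fin 3)))
              ((Finset.univ.filter (fun u : V => u ∈ (e : Sym2 V))).image Sum.inl))))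
    (hκ3 : ∀ e : {e : Sym2 V // e ∈ G.edgeFinset},
      κ (Sum.inr (e, (1 : Fin 3))) = {Sum.inr (e, (1 : Fin 3))})
    (hκ4 : ∀ e : {e : Sym2 V // e ∈ G.edgeFinset},
      κ (Sum.inr (e, (2 : Fin 3))) = {Sum.inr (e, (2 : Fin 3))}) :
    (∃ U : Finset V, h ≤ U.card ∧ ∀ a ∈ U, ∀ b ∈ U, a ≠ b → G.Adj a b) ↔
    (∃ W' : Finset (W15 G),
      ∀ c ∈ ({p, g, x} : Finset C),
        ((((Finset.univ : Finset (Fin (h * (h - 1) / 2) ⊕ Fin (2 * (h * (h - 1) / 2) - h))).image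
              Sum.inl ∪ (W'.biUnion κ).image Sum.inr : Finset (Voter15 G h))).filter
          (fun v => Sum.elim (Sum.elim (fun _ => p) (fun _ => g))
            (Sum.elim (fun _ => g) (fun ei => if ei.2 = (0 : Fin 3) then p else x)) v = c)).card ≤
        ((((Finset.univ : Finset (Fin (h * (h - 1) / 2) ⊕ Fin (2 * (h * (h - 1) / 2) - h))).image
              Sum.inl ∪ (W'.biUnion κ).image Sum.inr : Finset (Voter15 G h))).filter
          (fun v => Sum.elim (Sum.elim (fun _ => p) (fun _ => g))
            (Sum.elim (fun _ => g) (fun ei => if ei.2 = (0 : Fin 3) then p else x)) v = p)).card) := by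
  rw [show ∀ P : Finset (W15 G) → C → Prop, (∃ W', ∀ c ∈ ({p, g, x} : Finset C), P W' c) ↔
    ∃ W', P W' p ∧ P W' g ∧ P W' x by intro P; simp]
  simp only [card_filter_score15, if_true, hpg, hpx, hgx, hpg.symm, hpx.symm, hgx.symm, if_false,
    add_zero, zero_add, le_refl, true_and, ← Nat.choose_two_right]
  have hM : 2 * h.choose 2 = h * (h - 1) := by
    rw [Nat.choose_two_right, Nat.mul_div_cancel' (Nat.even_mul_pred_self h).two_dvd]
  have hhM : h ≤ 2 * h.choose 2 := hM ▸ Nat.le_mul_of_pos_right h (by omega)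
  constructor
  · rintro ⟨U, hU, hadj⟩
    obtain ⟨T, hTU, hT⟩ := Finset.exists_subset_card_eq hU
    let E : Finset {e : Sym2 V // e ∈ G.edgeFinset} :=
      Finset.univ.filter fun e => (e : Sym2 V) ∈ T.offDiag.image Sym2.mk.uncurry
    have hE : E.card = h.choose 2 := by
      rw [← hT, ← Sym2.card_image_offDiag, ← Finset.card_map (Function.Embedding.subtype _)]
      congr 1
      ext e
      simp only [E, Finset.mem_map, Finset.mem_filter, Finset.mem_univ, true_and,
        Function.Embedding.subtype_apply]
      constructor
      · rintro ⟨e, he, rfl⟩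
        exact he
      · intro he
        refine ⟨⟨e, ?_⟩, he, rfl⟩
        obtain ⟨⟨a, b⟩, hab, rfl⟩ := Finset.mem_image.1 he
        obtain ⟨ha, hb, hne⟩ := Finset.mem_offDiag.1 hab
        exact SimpleGraph.mem_edgeFinset.2 (hadj a (hTU ha) b (hTU hb) hne)
    let W' : Finset (W15 G) := E.image fun e => Sum.inr (e, (0 : Fin 3))
    have hB : ∀ w, w ∈ W'.biUnion κ ↔ ∃ e ∈ E, w ∈ κ (Sum.inr (e, (0 : Fin 3))) := by
      intro w
      rw [Finset.mem_biUnion]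
      exact Finset.exists_mem_image
    have h0 : (Finset.univ.filter fun e => Sum.inr (e, (0 : Fin 3)) ∈ W'.biUnion κ) = E := by
      ext e; simp [hB, hκ2, -Finset.mem_biUnion]
    have h1 : (Finset.univ.filter fun e => Sum.inr (e, (1 : Fin 3)) ∈ W'.biUnion κ) = E := by
      ext e; simp [hB, hκ2, -Finset.mem_biUnion]
    have h2 : (Finset.univ.filter fun e => Sum.inr (e, (2 : Fin 3)) ∈ W'.biUnion κ) = E := by
      ext e; simp [hB, hκ2, -Finset.mem_biUnion]
    have hu : (Finset.univ.filter fun u : V => Sum.inl u ∈ W'.biUnion κ) ⊆ T := by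
      intro u hu
      obtain ⟨e, he, hue⟩ := (hB _).1 (Finset.mem_filter.1 hu).2
      have hue : u ∈ (e : Sym2 V) := by simpa [hκ2] using hue
      obtain ⟨⟨a, b⟩, hab, hab'⟩ := Finset.mem_image.1 (Finset.mem_filter.1 he).2
      obtain ⟨ha, hb, -⟩ := Finset.mem_offDiag.1 hab
      rw [← hab'] at hue
      rcases Sym2.mem_iff.1 hue with rfl | rfl <;> assumption
    have hu := Finset.card_le_card hu
    refine ⟨W', ?_⟩
    rw [h0, h1, h2, hE]
    omega
  · rintro ⟨W', hg, hx⟩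
    have hmem : ∀ e, Sum.inr (e, (0 : Fin 3)) ∈ W'.biUnion κ →
        κ (Sum.inr (e, (0 : Fin 3))) ⊆ W'.biUnion κ := by
      intro e he
      obtain ⟨w, hw, hew⟩ := Finset.mem_biUnion.1 he
      have : w = Sum.inr (e, (0 : Fin 3)) := by
        rcases w with u | ⟨e', i⟩
        · simp [hκ1] at hew
        · match i with
          | 0 =>
            rw [hκ2] at hew
            have : e = e' := by simpa using hew
            rw [this]
          | 1 =>
            rw [hκ3] at hew
            simp at hew
          | 2 =>
            rw [hκ4] at hew
            simp at hew
      exact this ▸ Finset.subset_biUnion_of_mem κ hw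
    generalize W'.biUnion κ = B at hg hx hmem
    set F := Finset.univ.filter fun e : {e // e ∈ G.edgeFinset} => Sum.inr (e, (0 : Fin 3)) ∈ B
    set U := Finset.univ.filter fun u : V => Sum.inl u ∈ B
    have h1 : F.card ≤ (Finset.univ.filter fun e : {e // e ∈ G.edgeFinset} =>
        Sum.inr (e, (1 : Fin 3)) ∈ B).card :=
      Finset.card_le_card (Finset.monotone_filter_right _ fun e _ he =>
        hmem e he (by simp [hκ2]))
    have h2 : F.card ≤ (Finset.univ.filter fun e : {e // e ∈ G.edgeFinset} =>
        Sum.inr (e, (2 : Fin 3)) ∈ B).card :=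
      Finset.card_le_card (Finset.monotone_filter_right _ fun e _ he =>
        hmem e he (by simp [hκ2]))
    have hsub : F.map (Function.Embedding.subtype _) ⊆ U.offDiag.image Sym2.mk.uncurry := by
      intro e he
      obtain ⟨⟨e, heG⟩, heF, rfl⟩ := Finset.mem_map.1 he
      have hin : ∀ u ∈ e, u ∈ U := fun u hu => Finset.mem_filter.2 ⟨Finset.mem_univ _,
        hmem _ (Finset.mem_filter.1 heF).2 (by simp [hκ2, hu])⟩
      induction e with
      | _ a b =>
        exact Finset.mem_image.2 ⟨(a, b), Finset.mem_offDiag.2 ⟨hin a (Sym2.mem_mk_left a b),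
          hin b (Sym2.mem_mk_right a b), (SimpleGraph.mem_edgeFinset.1 heG).ne⟩, rfl⟩
    have hle := Finset.card_le_card hsub
    rw [Sym2.card_image_offDiag, Finset.card_map] at hle
    obtain ⟨hUc, hFc⟩ := choose_two_tight hh (by omega) hle (by omega)
    refine ⟨U, hUc.ge, adj_of_choose_le_card G U (F.map (Function.Embedding.subtype _)) ?_ hsub ?_⟩
    · intro e he
      obtain ⟨e, -, rfl⟩ := Finset.mem_map.1 he
      exact SimpleGraph.mem_edgeFinset.1 e.2
    · rw [Finset.card_map, hUc, hFc]
end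

section
/- Let X be a finite set and κ : X → 2^X a bundling function (x ∈ κ(x) for every x) that is symmetric (for all x, y: y ∈ κ(x) iff x ∈ κ(y)) and satisfies |κ(x)| ≤ 2 for every x ∈ X. Then κ is disjoint: for every two x, y ∈ X, either κ(x) = κ(y) or κ(x) ∩ κ(y) = ∅. -/
/-- A symmetric bundling function with bundles of size at most two is disjoint. -/
theorem stmt_16 {X : Type*} [Fintype X] [DecidableEq X]
    (κ : X → Finset X) (hbundle : ∀ x, x ∈ κ x)
    (hsym : ∀ x y : X, y ∈ κ x ↔ x ∈ κ y)
    (hcard : ∀ x, (κ x).card ≤ 2) :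
    ∀ x y : X, κ x = κ y ∨ κ x ∩ κ y = ∅ := by
  have pair_eq : ∀ w a b : X, a ≠ b → a ∈ κ w → b ∈ κ w → {a, b} = κ w := by
    intro w a b hab ha hb
    refine Finset.eq_of_subset_of_card_le ?_ ?_
    · simp [Finset.insert_subset_iff, ha, hb]
    · rw [Finset.card_pair hab]
      exact hcard w
  have eq_of_mem : ∀ x z : X, z ∈ κ x → κ x = κ z := by
    intro x z hz
    by_cases hxz : x = z
    · rw [hxz]
    · rw [← pair_eq x x z hxz (hbundle x) hz,
        ← pair_eq z x z hxz ((hsym x z).1 hz) (hbundle z)]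
  intro x y
  obtain h | ⟨z, hz⟩ := (κ x ∩ κ y).eq_empty_or_nonempty
  · exact Or.inr h
  · rw [Finset.mem_inter] at hz
    exact Or.inl ((eq_of_mem x z hz.1).trans (eq_of_mem y z hz.2).symm)
end

section
/- Let G be a finite simple undirected graph, let h ∈ ℕ with h ≥ 4, and let F ⊆ E(G) be a set of edges with |F| ≤ h(h−1)/2 and |F| − |V(F)| ≥ h(h−1)/2 − h, where V(F) denotes the set of all endpoints of edges in F. Then |V(F)| = h, |F| = h(h−1)/2, and V(F) is a clique of size h in G (all pairs of vertices of V(F) are adjacent in G). -/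
/-- Loopless edges with all endpoints in `S` lie among the pairs of distinct elements of `S`. -/
theorem subset_image_offDiag_of_endpoints {V : Type*} [DecidableEq V]
    {F : Finset (Sym2 V)} {S : Finset V} (hdiag : ∀ e ∈ F, ¬ e.IsDiag)
    (hS : ∀ e ∈ F, ∀ u ∈ e, u ∈ S) :
    F ⊆ S.offDiag.image (fun p : V × V => s(p.1, p.2)) := by
  intro e he
  induction e with
  | _ a b =>
    refine Finset.mem_image.2 ⟨(a, b), Finset.mem_offDiag.2 ⟨?_, ?_, ?_⟩, rfl⟩
    · exact hS _ he a (Sym2.mem_mk_left a b)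
    · exact hS _ he b (Sym2.mem_mk_right a b)
    · exact fun hab => hdiag _ he (Sym2.mk_isDiag_iff.2 hab)


/-- Edge-counting lemma: if F ⊆ E(G) has at most h(h−1)/2 edges and
|F| − |V(F)| ≥ h(h−1)/2 − h (with h ≥ 4), then |V(F)| = h, |F| = h(h−1)/2 and
the endpoints V(F) form a clique of size h in G. -/
theorem stmt_17 {V : Type*} [Fintype V] [DecidableEq V]
    (G : SimpleGraph V) [DecidableRel G.Adj]
    (h : ℕ) (hh : 4 ≤ h)
    (F : Finset (Sym2 V)) (hF : F ⊆ G.edgeFinset)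
    (hcard : F.card ≤ h * (h - 1) / 2)
    (hlow : ((h * (h - 1) / 2 : ℕ) : ℤ) - (h : ℤ) ≤
      (F.card : ℤ) - ((Finset.univ.filter (fun u : V => ∃ e ∈ F, u ∈ e)).card : ℤ)) :
    (Finset.univ.filter (fun u : V => ∃ e ∈ F, u ∈ e)).card = h ∧
    F.card = h * (h - 1) / 2 ∧
    ∀ a ∈ Finset.univ.filter (fun u : V => ∃ e ∈ F, u ∈ e),
      ∀ b ∈ Finset.univ.filter (fun u : V => ∃ e ∈ F, u ∈ e),
        a ≠ b → G.Adj a b := by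
  set S := Finset.univ.filter (fun u : V => ∃ e ∈ F, u ∈ e) with hSdef
  have hsub : F ⊆ S.offDiag.image (fun p : V × V => s(p.1, p.2)) :=
    subset_image_offDiag_of_endpoints
      (fun e he => G.not_isDiag_of_mem_edgeFinset (hF he))
      (fun e he u hu => Finset.mem_filter.2 ⟨Finset.mem_univ u, e, he, hu⟩)
  have himage : (S.offDiag.image (fun p : V × V => s(p.1, p.2))).card =
      S.card * (S.card - 1) / 2 :=
    (Sym2.card_image_offDiag S).trans (Nat.choose_two_right _)
  have hle : F.card ≤ S.card * (S.card - 1) / 2 := himage ▸ Finset.card_le_card hsub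
  have hSle : S.card ≤ h := by omega
  have hSh : S.card = h := by
    by_contra hne
    have hlt : S.card < h := lt_of_le_of_ne hSle hne
    have hpairs : h * (h - 1) / 2 * 2 = h * (h - 1) :=
      Nat.div_mul_cancel (Nat.even_mul_pred_self h).two_dvd
    have hdiv := Nat.div_mul_le_self (S.card * (S.card - 1)) 2
    generalize S.card = v at *
    generalize h * (h - 1) / 2 = m at *
    generalize v * (v - 1) / 2 = k at *
    obtain ⟨n, rfl⟩ : ∃ n, h = n + 1 := ⟨h - 1, by omega⟩
    rw [Nat.add_sub_cancel] at hpairs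
    rcases v with _ | w
    · simp at hdiv
      push_cast at hlow
      nlinarith
    · rw [Nat.add_sub_cancel] at hdiv
      push_cast at hlow
      zify at *
      nlinarith
  have hFcard : F.card = h * (h - 1) / 2 := by omega
  refine ⟨hSh, hFcard, fun a ha b hb hab => ?_⟩
  have heq : F = S.offDiag.image (fun p : V × V => s(p.1, p.2)) :=
    Finset.eq_of_subset_of_card_le hsub (by rw [himage, hFcard, hSh])
  have hmem : s(a, b) ∈ F := by
    rw [heq]
    exact Finset.mem_image.2 ⟨(a, b), Finset.mem_offDiag.2 ⟨ha, hb, hab⟩, rfl⟩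
  exact SimpleGraph.mem_edgeFinset.1 (hF hmem)
end
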